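/- Let V be a MOSVA and W a V-bimodule, both satisfying the pole-order condition. Let u_1, u_2 ∈ V and let f ∈ W̃_{z_3,…,z_{n+2}} be such that Y_W^L(u_1,z_1)Y_W^{s(R)}(u_2,z_2)f(z_3,…,z_{n+2}) converges absolutely to a \overline{W}-valued rational function for every (z_1,…,z_{n+2}) ∈ F_{n+2}ℂ with |z_1| > |z_2| > |z_i| (i = 3,…,n+2). Then the series Y_W^{s(R)}(u_2,z_2)Y_W^L(u_1,z_1)f(z_3,…,z_{n+2}) also converges absolutely to the same \overline{W}-valued rational function for every (z_1,…,z_{n+2}) ∈ F_{n+2}ℂ with |z_2| > |z_1| > |z_i| (i = 3,…,n+2), and E(Y_W^L(u_1,z_1)Y_W^{s(R)}(u_2,z_2)f(z_3,…,z_{n+2})) = E(Y_W^{s(R)}(u_2,z_2)Y_W^L(u_1,z_1)f(z_3,…,z_{n+2})) as elements of W̃_{z_1,…,z_{n+2}}. -/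

import Mathlib

set_option autoImplicit false
set_option maxHeartbeats 1000000

open scoped BigOperators

noncomputable section

namespace VA

/-- Absolute convergence of a series of complex numbers indexed by `ι` to the sum `s`. -/
def AbsConvTo {ι : Type*} (f : ι → ℂ) (s : ℂ) : Prop :=
  Summable (fun i => ‖f i‖) ∧ HasSum f s

/-- The configuration-space condition: the entries of `z` are pairwise distinct. -/
def Conf {ι : Type*} (z : ι → ℂ) : Prop := ∀ i j : ι, i ≠ j → z i ≠ z j

/-- `‖z 0‖ > ‖z 1‖ > ⋯ > ‖z (n-1)‖`. -/
def Ordered {n : ℕ} (z : Fin n → ℂ) : Prop := ∀ i j : Fin n, i < j → ‖z j‖ < ‖z i‖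

/-- `‖z 0‖ > ‖z 1‖ > ⋯ > ‖z (n-1)‖ > 0`. -/
def OrderedPos {n : ℕ} (z : Fin n → ℂ) : Prop := Ordered z ∧ ∀ i, 0 < ‖z i‖

/-- A rational function in the variables `z i`, `i : ι`, whose only possible poles are
at `z i = 0` and on the diagonals `z i = z j` (`i ≠ j`); it is recorded as a numerator
polynomial together with the orders of the poles. -/
structure RatFn (ι : Type*) [Fintype ι] [DecidableEq ι] where
  num : MvPolynomial ι ℂ
  a : ι → ℕ
  b : ι → ι → ℕ

def RatFn.eval {ι : Type*} [Fintype ι] [DecidableEq ι] (R : RatFn ι) (z : ι → ℂ) : ℂ :=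
  MvPolynomial.eval z R.num /
    ((∏ i, z i ^ R.a i) * ∏ q ∈ Finset.univ.offDiag, (z q.1 - z q.2) ^ R.b q.1 q.2)

/-- A rational function in the variables `z i`, `i : ι`, whose only possible poles are
on the diagonals `z i = z j` (`i ≠ j`). -/
structure DiagRatFn (ι : Type*) [Fintype ι] [DecidableEq ι] where
  num : MvPolynomial ι ℂ
  b : ι → ι → ℕ

def DiagRatFn.eval {ι : Type*} [Fintype ι] [DecidableEq ι] (R : DiagRatFn ι) (z : ι → ℂ) : ℂ :=
  MvPolynomial.eval z R.num / ∏ q ∈ Finset.univ.offDiag, (z q.1 - z q.2) ^ R.b q.1 q.2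

/-- A linear functional belongs to the graded dual iff its restriction to all but
finitely many homogeneous components vanishes. -/
def InGradedDual {ι : Type*} {M : Type*} [AddCommGroup M] [Module ℂ M]
    (proj : ι → M →ₗ[ℂ] M) (φ : M →ₗ[ℂ] ℂ) : Prop :=
  (Function.support fun i => φ ∘ₗ proj i).Finite

/-- Iterated application: `compApply n f w = f 0 (f 1 (⋯ (f (n-1) w)))`. -/
def compApply {M : Type*} : (n : ℕ) → (Fin n → (M → M)) → M → M
  | 0, _, w => w
  | n+1, f, w => f 0 (compApply n (fun i => f i.succ) w)

section Graded

variable (W : Type*) [AddCommGroup W] [Module ℂ W]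

/-- A `ℂ`-grading of `W`, recorded via the projections onto the homogeneous
subspaces, whose weights have lower-bounded real parts. -/
structure CGrading where
  proj : ℂ → W →ₗ[ℂ] W
  proj_comp : ∀ m n : ℂ, proj m ∘ₗ proj n = if m = n then proj n else 0
  proj_finite : ∀ w : W, (Function.support fun n => proj n w).Finite
  proj_sum : ∀ w : W, (∑ᶠ n : ℂ, proj n w) = w
  lower_bound : ∃ B : ℝ, ∀ n : ℂ, n.re < B → proj n = 0

/-- A `ℤ`-grading of `V` with lower-bounded weights. -/
structure ZGrading where
  proj : ℤ → W →ₗ[ℂ] W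
  proj_comp : ∀ m n : ℤ, proj m ∘ₗ proj n = if m = n then proj n else 0
  proj_finite : ∀ w : W, (Function.support fun n => proj n w).Finite
  proj_sum : ∀ w : W, (∑ᶠ n : ℤ, proj n w) = w
  lower_bound : ∃ B : ℤ, ∀ n : ℤ, n < B → proj n = 0

variable {W}

/-- The grading operator `d` of a `ℂ`-graded space. -/
def CGrading.d (G : CGrading W) (w : W) : W := ∑ᶠ n : ℂ, n • G.proj n w

/-- The grading operator `d` of a `ℤ`-graded space. -/
def ZGrading.d (G : ZGrading W) (v : W) : W := ∑ᶠ n : ℤ, (n : ℂ) • G.proj n v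

/-- The operator `z^d` on a `ℤ`-graded space. -/
def ZGrading.zd (G : ZGrading W) (z : ℂ) (v : W) : W := ∑ᶠ n : ℤ, (z ^ n) • G.proj n v

/-- The algebraic completion `∏ₙ W_[n]`, realized as the submodule of functions
`ℂ → W` recording a homogeneous component in each weight. -/
def CGrading.compSub (G : CGrading W) : Submodule ℂ (ℂ → W) where
  carrier := {f | ∀ n, G.proj n (f n) = f n}
  add_mem' := by
    intro a b ha hb n
    simp only [Pi.add_apply, map_add, ha n, hb n]
  zero_mem' := by
    intro n
    simp
  smul_mem' := by
    intro c f hf n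
    simp only [Pi.smul_apply, map_smul, hf n]

/-- The algebraic completion of a graded space. -/
abbrev CGrading.Comp (G : CGrading W) : Type _ := ↥G.compSub

/-- The pairing between the graded dual and the algebraic completion. -/
def CGrading.pair (G : CGrading W) (φ : W →ₗ[ℂ] ℂ) (f : G.Comp) : ℂ :=
  ∑ᶠ n : ℂ, φ (f.1 n)

/-- The embedding of `W` into its algebraic completion. -/
def CGrading.emb (G : CGrading W) (w : W) : G.Comp :=
  ⟨fun n => G.proj n w, by
    intro n
    have h := congrArg (fun T : W →ₗ[ℂ] W => T w) (G.proj_comp n n)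
    simpa using h⟩

/-- The componentwise extension of an operator on `W` to the algebraic completion. -/
def CGrading.ext (G : CGrading W) (L : W → W) (f : G.Comp) : G.Comp :=
  ⟨fun m => ∑ᶠ n : ℂ, G.proj m (L (f.1 n)), by
    intro m
    show G.proj m (∑ᶠ n : ℂ, G.proj m (L (f.1 n))) = ∑ᶠ n : ℂ, G.proj m (L (f.1 n))
    by_cases h : (Function.support fun n => G.proj m (L (f.1 n))).Finite
    · have h1 := AddMonoidHom.map_finsum (G.proj m).toAddMonoidHom h
      simp only [LinearMap.toAddMonoidHom_coe] at h1
      rw [h1]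
      refine finsum_congr fun n => ?_
      have h2 := congrArg (fun T : W →ₗ[ℂ] W => T (L (f.1 n))) (G.proj_comp m m)
      simpa using h2
    · rw [finsum_of_infinite_support h]
      simp⟩

/-- The operator `z^d` on the algebraic completion, acting on the component of
weight `n` by `z ^ n` (complex power). -/
def CGrading.zd (G : CGrading W) (z : ℂ) (f : G.Comp) : G.Comp :=
  ⟨fun n => (z ^ n) • f.1 n, by
    intro n
    rw [map_smul, f.2 n]⟩

end Graded


section VOA

/-- A meromorphic open-string vertex algebra (MOSVA): a lower-bounded `ℤ`-graded
space with a vertex operator map (recorded through its coefficients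
`Y u v k = (Y_V)_k(u)v`, the coefficient of `x^{-k-1}` in `Y_V(u,x)v`) and a
vacuum, satisfying the grading, vacuum, `D`-derivative/commutator, rationality and
associativity axioms. -/
structure MOSVA (V : Type*) [AddCommGroup V] [Module ℂ V] where
  gr : ZGrading V
  Y : V →ₗ[ℂ] V →ₗ[ℂ] (ℤ → V)
  vac : V
  /-- lower truncation of vertex operators -/
  trunc : ∀ u v : V, ∃ N : ℤ, ∀ k : ℤ, N ≤ k → Y u v k = 0
  /-- identity property `Y(𝟏,x) = 1` -/
  identity : ∀ (v : V) (k : ℤ), Y vac v k = if k = -1 then v else 0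
  /-- creation property: `Y(u,x)𝟏 ∈ V[[x]]` and `lim_{x→0} Y(u,x)𝟏 = u` -/
  creation : ∀ (u : V) (k : ℤ), 0 ≤ k → Y u vac k = 0
  creation_lim : ∀ u : V, Y u vac (-1) = u
  /-- the `d`-commutator formula, written in terms of coefficients -/
  d_comm : ∀ (u v : V) (k : ℤ),
    gr.d (Y u v k) = Y (gr.d u) v k + (-(k : ℂ) - 1) • Y u v k + Y u (gr.d v) k
  /-- the `D`-derivative property (`D_V u = (Y_V)_{-2}(u)𝟏`) -/
  D_deriv : ∀ (u v : V) (k : ℤ),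
    Y (Y u vac (-2)) v k = (-(k : ℂ)) • Y u v (k - 1)
  /-- the `D`-commutator formula -/
  D_comm : ∀ (u v : V) (k : ℤ),
    Y (Y u v k) vac (-2) - Y u (Y v vac (-2)) k = (-(k : ℂ)) • Y u v (k - 1)
  /-- rationality of products: matrix coefficients of products of vertex operators
  converge absolutely in the ordered region to rational functions with the only
  possible poles at `z i = 0` and `z i = z j` -/
  rationality : ∀ (n : ℕ) (u : Fin n → V) (v : V) (φ : V →ₗ[ℂ] ℂ),
    InGradedDual gr.proj φ → ∃ R : RatFn (Fin n), ∀ z : Fin n → ℂ, OrderedPos z →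
      AbsConvTo (fun k : Fin n → ℤ =>
          φ (compApply n (fun i x => Y (u i) x (k i)) v) * ∏ i, z i ^ (-(k i) - 1))
        (R.eval z)
  /-- rationality of iterates and associativity: products and iterates converge to a
  common rational function -/
  associativity : ∀ (u₁ u₂ v : V) (φ : V →ₗ[ℂ] ℂ), InGradedDual gr.proj φ →
    ∃ R : RatFn (Fin 2),
      (∀ z₁ z₂ : ℂ, ‖z₂‖ < ‖z₁‖ → 0 < ‖z₂‖ →
        AbsConvTo (fun k : ℤ × ℤ =>
            φ (Y u₁ (Y u₂ v k.2) k.1) * z₁ ^ (-k.1 - 1) * z₂ ^ (-k.2 - 1))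
          (R.eval ![z₁, z₂])) ∧
      (∀ z₁ z₂ : ℂ, ‖z₁ - z₂‖ < ‖z₂‖ → 0 < ‖z₁ - z₂‖ →
        AbsConvTo (fun k : ℤ × ℤ =>
            φ (Y (Y u₁ u₂ k.1) v k.2) * (z₁ - z₂) ^ (-k.1 - 1) * z₂ ^ (-k.2 - 1))
          (R.eval ![z₁, z₂]))

variable {V : Type*} [AddCommGroup V] [Module ℂ V]

/-- The operator `D_V`. -/
def MOSVA.D (A : MOSVA V) (v : V) : V := A.Y v A.vac (-2)

/-- The pole-order condition for a MOSVA. -/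
def MOSVA.PoleOrder (A : MOSVA V) : Prop :=
  ∀ u₁ v : V, ∃ C : ℕ, ∀ φ : V →ₗ[ℂ] ℂ, InGradedDual A.gr.proj φ → ∀ u₂ : V,
    ∃ R : RatFn (Fin 2), R.a 0 ≤ C ∧
      ∀ z₁ z₂ : ℂ, ‖z₂‖ < ‖z₁‖ → 0 < ‖z₂‖ →
        AbsConvTo (fun k : ℤ × ℤ =>
            φ (A.Y u₁ (A.Y u₂ v k.2) k.1) * z₁ ^ (-k.1 - 1) * z₂ ^ (-k.2 - 1))
          (R.eval ![z₁, z₂])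

/-- A bimodule for a MOSVA: a `ℂ`-graded space with left and right vertex operator
maps (recorded through their coefficients), satisfying the left module, right module
and compatibility axioms. -/
structure Bimod (A : MOSVA V) (W : Type*) [AddCommGroup W] [Module ℂ W] where
  gr : CGrading W
  YL : V →ₗ[ℂ] W →ₗ[ℂ] (ℤ → W)
  YR : W →ₗ[ℂ] V →ₗ[ℂ] (ℤ → W)
  DW : W →ₗ[ℂ] W
  /-- `D_W` has weight one -/
  DW_wt : ∀ n : ℂ, DW ∘ₗ gr.proj n = gr.proj (n + 1) ∘ₗ DW ∘ₗ gr.proj n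
  truncL : ∀ (u : V) (w : W), ∃ N : ℤ, ∀ k : ℤ, N ≤ k → YL u w k = 0
  truncR : ∀ (w : W) (u : V), ∃ N : ℤ, ∀ k : ℤ, N ≤ k → YR w u k = 0
  identityL : ∀ (w : W) (k : ℤ), YL A.vac w k = if k = -1 then w else 0
  creationR : ∀ (w : W) (k : ℤ), 0 ≤ k → YR w A.vac k = 0
  creationR_lim : ∀ w : W, YR w A.vac (-1) = w
  d_commL : ∀ (u : V) (w : W) (k : ℤ),
    gr.d (YL u w k) = YL (A.gr.d u) w k + (-(k : ℂ) - 1) • YL u w k + YL u (gr.d w) k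
  d_commR : ∀ (w : W) (u : V) (k : ℤ),
    gr.d (YR w u k) = YR (gr.d w) u k + (-(k : ℂ) - 1) • YR w u k + YR w (A.gr.d u) k
  D_derivL : ∀ (u : V) (w : W) (k : ℤ),
    YL (A.D u) w k = (-(k : ℂ)) • YL u w (k - 1)
  D_commL : ∀ (u : V) (w : W) (k : ℤ),
    DW (YL u w k) - YL u (DW w) k = (-(k : ℂ)) • YL u w (k - 1)
  D_derivR : ∀ (w : W) (u : V) (k : ℤ),
    YR (DW w) u k = (-(k : ℂ)) • YR w u (k - 1)
  D_commR : ∀ (w : W) (u : V) (k : ℤ),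
    DW (YR w u k) - YR w (A.D u) k = (-(k : ℂ)) • YR w u (k - 1)
  /-- rationality for products of left vertex operators -/
  rationalityL : ∀ (n : ℕ) (u : Fin n → V) (w : W) (φ : W →ₗ[ℂ] ℂ),
    InGradedDual gr.proj φ → ∃ R : RatFn (Fin n), ∀ z : Fin n → ℂ, OrderedPos z →
      AbsConvTo (fun k : Fin n → ℤ =>
          φ (compApply n (fun i x => YL (u i) x (k i)) w) * ∏ i, z i ^ (-(k i) - 1))
        (R.eval z)
  /-- rationality of iterates and associativity for the left vertex operator map -/
  associativityL : ∀ (u₁ u₂ : V) (w : W) (φ : W →ₗ[ℂ] ℂ), InGradedDual gr.proj φ →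
    ∃ R : RatFn (Fin 2),
      (∀ z₁ z₂ : ℂ, ‖z₂‖ < ‖z₁‖ → 0 < ‖z₂‖ →
        AbsConvTo (fun k : ℤ × ℤ =>
            φ (YL u₁ (YL u₂ w k.2) k.1) * z₁ ^ (-k.1 - 1) * z₂ ^ (-k.2 - 1))
          (R.eval ![z₁, z₂])) ∧
      (∀ z₁ z₂ : ℂ, ‖z₁ - z₂‖ < ‖z₂‖ → 0 < ‖z₁ - z₂‖ →
        AbsConvTo (fun k : ℤ × ℤ =>
            φ (YL (A.Y u₁ u₂ k.1) w k.2) * (z₁ - z₂) ^ (-k.1 - 1) * z₂ ^ (-k.2 - 1))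
          (R.eval ![z₁, z₂]))
  /-- rationality for products `Y_W^R(w,z₁)Y_V(u₁,z₂)⋯Y_V(u_{n-1},z_n)u_n` -/
  rationalityR : ∀ (n : ℕ) (w : W) (v : Fin (n+1) → V) (φ : W →ₗ[ℂ] ℂ),
    InGradedDual gr.proj φ → ∃ R : RatFn (Fin (n+1)),
      ∀ z : Fin (n+1) → ℂ, OrderedPos z →
        AbsConvTo (fun k : Fin (n+1) → ℤ =>
            φ (YR w (compApply n (fun i x => A.Y (v i.castSucc) x (k i.succ))
                (v (Fin.last n))) (k 0)) * ∏ i, z i ^ (-(k i) - 1))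
          (R.eval z)
  /-- rationality of iterates and associativity for the right vertex operator map -/
  associativityR : ∀ (w : W) (u₁ u₂ : V) (φ : W →ₗ[ℂ] ℂ), InGradedDual gr.proj φ →
    ∃ R : RatFn (Fin 2),
      (∀ z₁ z₂ : ℂ, ‖z₂‖ < ‖z₁‖ → 0 < ‖z₂‖ →
        AbsConvTo (fun k : ℤ × ℤ =>
            φ (YR w (A.Y u₁ u₂ k.2) k.1) * z₁ ^ (-k.1 - 1) * z₂ ^ (-k.2 - 1))
          (R.eval ![z₁, z₂])) ∧
      (∀ z₁ z₂ : ℂ, ‖z₁ - z₂‖ < ‖z₂‖ → 0 < ‖z₁ - z₂‖ →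
        AbsConvTo (fun k : ℤ × ℤ =>
            φ (YR (YR w u₁ k.1) u₂ k.2) * (z₁ - z₂) ^ (-k.1 - 1) * z₂ ^ (-k.2 - 1))
          (R.eval ![z₁, z₂]))
  /-- compatibility: rationality of mixed products
  `Y_W^L(u₁,z₁)⋯Y_W^L(u_p,z_p)Y_W^R(w,z₀)Y_V(v₁,⋅)⋯Y_V(v_{q},⋅)v_{q+1}` -/
  compatRat : ∀ (p q : ℕ) (u : Fin p → V) (w : W) (v : Fin (q+1) → V)
      (φ : W →ₗ[ℂ] ℂ), InGradedDual gr.proj φ →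
    ∃ R : RatFn (Fin p ⊕ Fin (q+1)),
      ∀ (zL : Fin p → ℂ) (z0 : ℂ) (zR : Fin q → ℂ),
        Ordered zL → (∀ i, ‖z0‖ < ‖zL i‖) → (∀ j, ‖zR j‖ < ‖z0‖) → Ordered zR →
        0 < ‖z0‖ → (∀ j, 0 < ‖zR j‖) →
        AbsConvTo (fun K : (Fin p → ℤ) × ℤ × (Fin q → ℤ) =>
            φ (compApply p (fun i x => YL (u i) x (K.1 i))
                (YR w (compApply q (fun j x => A.Y (v j.castSucc) x (K.2.2 j))
                  (v (Fin.last q))) K.2.1))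
              * (∏ i, zL i ^ (-(K.1 i) - 1)) * z0 ^ (-K.2.1 - 1)
              * ∏ j, zR j ^ (-(K.2.2 j) - 1))
          (R.eval (Sum.elim zL (Fin.cons z0 zR)))
  /-- compatibility: associativity for the left and right vertex operator maps -/
  compatAssoc : ∀ (u v : V) (w : W) (φ : W →ₗ[ℂ] ℂ), InGradedDual gr.proj φ →
    ∃ R : RatFn (Fin 2),
      (∀ z₁ z₂ : ℂ, ‖z₂‖ < ‖z₁‖ → 0 < ‖z₂‖ →
        AbsConvTo (fun k : ℤ × ℤ =>
            φ (YL u (YR w v k.2) k.1) * z₁ ^ (-k.1 - 1) * z₂ ^ (-k.2 - 1))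
          (R.eval ![z₁, z₂])) ∧
      (∀ z₁ z₂ : ℂ, ‖z₁ - z₂‖ < ‖z₂‖ → 0 < ‖z₁ - z₂‖ →
        AbsConvTo (fun k : ℤ × ℤ =>
            φ (YR (YL u w k.1) v k.2) * (z₁ - z₂) ^ (-k.1 - 1) * z₂ ^ (-k.2 - 1))
          (R.eval ![z₁, z₂]))

variable {W : Type*} [AddCommGroup W] [Module ℂ W] {A : MOSVA V}

/-- The opposite right vertex operator map
`Y_W^{s(R)}(v,x)w = e^{xD_W}Y_W^R(w,-x)v`, through its coefficients. -/
def Bimod.YsR (B : Bimod A W) (v : V) (w : W) (k : ℤ) : W :=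
  ∑ᶠ m : ℕ, (((-1 : ℂ) ^ (k + (m : ℤ) + 1)) * ((m.factorial : ℂ))⁻¹) •
    ((B.DW ^ m) (B.YR w v (k + (m : ℤ))))

/-- The pole-order condition for a bimodule over a MOSVA. -/
def Bimod.PoleOrder (B : Bimod A W) : Prop :=
  (∀ (u₁ : V) (w : W), ∃ C : ℕ, ∀ φ : W →ₗ[ℂ] ℂ, InGradedDual B.gr.proj φ → ∀ u₂ : V,
    ∃ R : RatFn (Fin 2), R.a 0 ≤ C ∧
      ∀ z₁ z₂ : ℂ, ‖z₂‖ < ‖z₁‖ → 0 < ‖z₂‖ →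
        AbsConvTo (fun k : ℤ × ℤ =>
            φ (B.YL u₁ (B.YL u₂ w k.2) k.1) * z₁ ^ (-k.1 - 1) * z₂ ^ (-k.2 - 1))
          (R.eval ![z₁, z₂])) ∧
  (∀ (u₂ : V) (w : W), ∃ C : ℕ, ∀ φ : W →ₗ[ℂ] ℂ, InGradedDual B.gr.proj φ → ∀ u₁ : V,
    ∃ R : RatFn (Fin 2), R.a 0 ≤ C ∧
      ∀ z₁ z₂ : ℂ, ‖z₂‖ < ‖z₁‖ → 0 < ‖z₂‖ →
        AbsConvTo (fun k : ℤ × ℤ =>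
            φ (B.YR w (A.Y u₁ u₂ k.2) k.1) * z₁ ^ (-k.1 - 1) * z₂ ^ (-k.2 - 1))
          (R.eval ![z₁, z₂])) ∧
  (∀ (u₁ u₂ : V), ∃ C : ℕ, ∀ φ : W →ₗ[ℂ] ℂ, InGradedDual B.gr.proj φ → ∀ w : W,
    ∃ R : RatFn (Fin 2), R.a 0 ≤ C ∧
      ∀ z₁ z₂ : ℂ, ‖z₂‖ < ‖z₁‖ → 0 < ‖z₂‖ →
        AbsConvTo (fun k : ℤ × ℤ =>
            φ (B.YL u₁ (B.YR w u₂ k.2) k.1) * z₁ ^ (-k.1 - 1) * z₂ ^ (-k.2 - 1))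
          (R.eval ![z₁, z₂]))

end VOA


section Cochains

variable {V : Type*} [AddCommGroup V] [Module ℂ V]
variable {W : Type*} [AddCommGroup W] [Module ℂ W] {A : MOSVA V}

/-- A `W̄`-valued rational function in the variables `z i`, `i : ι`, with the only
possible poles at `z i = z j`: a map from configuration space to the algebraic
completion whose pairings with graded-dual functionals are such rational functions,
with pole orders uniform in the functional, as witnessed by a formal power series
with coefficients in `W` (condition (ii)). -/
def CGrading.WTilde (G : CGrading W) {ι : Type*} [Fintype ι] [DecidableEq ι]
    (f : (ι → ℂ) → G.Comp) : Prop :=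
  (∀ φ : W →ₗ[ℂ] ℂ, InGradedDual G.proj φ →
      ∃ R : DiagRatFn ι, ∀ z : ι → ℂ, Conf z → G.pair φ (f z) = R.eval z) ∧
  ∃ (p : ι → ι → ℤ) (b : (ι → ℕ) → W),
    ∀ φ : W →ₗ[ℂ] ℂ, InGradedDual G.proj φ →
      (Function.support fun k => φ (b k)).Finite ∧
      ∀ z : ι → ℂ, Conf z →
        (∏ q ∈ Finset.univ.offDiag, (z q.1 - z q.2) ^ (p q.1 q.2)) * G.pair φ (f z)
          = ∑ᶠ k : ι → ℕ, φ (b k) * ∏ i, z i ^ (k i)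

/-- The pattern of left/right vertex operators: the `i`-th operator is
`Y_W^L(u i, z i)` if `isL i`, and `Y_W^{s(R)}(u i, z i)` otherwise; `k` records the
coefficient extracted from each operator. -/
def patOps (B : Bimod A W) {n : ℕ} (isL : Fin n → Bool) (u : Fin n → V)
    (k : Fin n → ℤ) : Fin n → (W → W) :=
  fun i => if isL i then fun x => B.YL (u i) x (k i) else fun x => B.YsR (u i) x (k i)

/-- The pattern with `l` left operators followed by `n - l` opposite right operators. -/
def prefixPat (n l : ℕ) : Fin n → Bool := fun i => decide ((i : ℕ) < l)

/-- A vector `w` such that `Y_W^L(u,x)w ∈ W[[x]]` and `Y_W^{s(R)}(u,x)w ∈ W[[x]]`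
for every `u ∈ V`. -/
def Bimod.RegVec (B : Bimod A W) (w : W) : Prop :=
  ∀ (u : V) (k : ℤ), 0 ≤ k → B.YL u w k = 0 ∧ B.YsR u w k = 0

/-- `f` represents the `W̄`-valued rational function
`E(Y^{L/sR}(u 0, z 0)⋯Y^{L/sR}(u (n-1), z (n-1)) w)` (with the operators prescribed
by the pattern `isL`): `f` is a `W̄`-valued rational function with only diagonal
poles whose pairings are the sums of the corresponding series of matrix coefficients
on the region `|z 0| > ⋯ > |z (n-1)| > 0`. -/
def RepEPat (B : Bimod A W) {n : ℕ} (isL : Fin n → Bool) (u : Fin n → V) (w : W)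
    (f : (Fin n → ℂ) → B.gr.Comp) : Prop :=
  B.gr.WTilde f ∧
  ∀ φ : W →ₗ[ℂ] ℂ, InGradedDual B.gr.proj φ → ∀ z : Fin n → ℂ, OrderedPos z →
    AbsConvTo (fun k : Fin n → ℤ =>
        φ (compApply n (patOps B isL u k) w) * ∏ i, z i ^ (-(k i) - 1))
      (B.gr.pair φ (f z))

/-- `f` represents the `W̄`-valued rational function given by a product of groups of
vertex operators, with group `i` of size `α i` and left/right pattern `isL`;
the variables are indexed by the sigma type `(i : Fin N) × Fin (α i)`. -/
def RepESig (B : Bimod A W) {N : ℕ} (α : Fin N → ℕ)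
    (isL : (i : Fin N) → Fin (α i) → Bool)
    (u : (i : Fin N) → Fin (α i) → V) (w : W)
    (f : (((i : Fin N) × Fin (α i)) → ℂ) → B.gr.Comp) : Prop :=
  B.gr.WTilde f ∧
  ∀ φ : W →ₗ[ℂ] ℂ, InGradedDual B.gr.proj φ →
    ∀ Z : (i : Fin N) → Fin (α i) → ℂ,
      (∀ (i : Fin N) (s t : Fin (α i)), s < t → ‖Z i t‖ < ‖Z i s‖) →
      (∀ (i j : Fin N), i < j → ∀ (s : Fin (α i)) (t : Fin (α j)), ‖Z j t‖ < ‖Z i s‖) →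
      (∀ (i : Fin N) (s : Fin (α i)), 0 < ‖Z i s‖) →
      AbsConvTo (fun K : (i : Fin N) → Fin (α i) → ℤ =>
          φ (compApply N (fun i x => compApply (α i) (fun s y =>
              if isL i s then B.YL (u i s) y (K i s) else B.YsR (u i s) y (K i s)) x) w)
            * ∏ i, ∏ s, Z i s ^ (-(K i s) - 1))
        (B.gr.pair φ (f (fun q => Z q.1 q.2)))

/-- Multilinearity of a map on `n`-tuples of vectors. -/
def IsMultilinear {M : Type*} [AddCommMonoid M] [Module ℂ M] {n : ℕ}
    (Φ : (Fin n → V) → M) : Prop :=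
  (∀ (v : Fin n → V) (i : Fin n) (x y : V),
      Φ (Function.update v i (x + y)) = Φ (Function.update v i x) + Φ (Function.update v i y)) ∧
  ∀ (v : Fin n → V) (i : Fin n) (c : ℂ) (x : V),
      Φ (Function.update v i (c • x)) = c • Φ (Function.update v i x)

/-- The `D`-derivative property of a map `Φ : V^{⊗n} → W̃_{z₁,…,zₙ}`. -/
def DDerivProp (A : MOSVA V) (B : Bimod A W) {n : ℕ}
    (Φ : (Fin n → V) → (Fin n → ℂ) → B.gr.Comp) : Prop :=
  (∀ (v : Fin n → V) (i : Fin n) (φ : W →ₗ[ℂ] ℂ), InGradedDual B.gr.proj φ →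
    ∀ z : Fin n → ℂ, Conf z →
      HasDerivAt (fun t : ℂ => B.gr.pair φ (Φ v (Function.update z i t)))
        (B.gr.pair φ (Φ (Function.update v i (A.D (v i))) z)) (z i)) ∧
  (∀ (v : Fin n → V) (φ : W →ₗ[ℂ] ℂ), InGradedDual B.gr.proj φ →
    ∀ z : Fin n → ℂ, Conf z →
      B.gr.pair φ (B.gr.ext (⇑B.DW) (Φ v z)) =
        ∑ i, B.gr.pair φ (Φ (Function.update v i (A.D (v i))) z))

/-- The `d`-conjugation property of a map `Φ : V^{⊗n} → W̃_{z₁,…,zₙ}`. -/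
def DConjProp (A : MOSVA V) (B : Bimod A W) {n : ℕ}
    (Φ : (Fin n → V) → (Fin n → ℂ) → B.gr.Comp) : Prop :=
  ∀ (v : Fin n → V) (φ : W →ₗ[ℂ] ℂ), InGradedDual B.gr.proj φ →
    ∀ (z : Fin n → ℂ) (c : ℂ), c ≠ 0 → Conf z → Conf (fun i => c * z i) →
      B.gr.pair φ (B.gr.zd c (Φ v z)) =
        B.gr.pair φ (Φ (fun i => A.gr.zd c (v i)) (fun i => c * z i))

/-- Composability of `Φ : V^{⊗n} → W̃` with `m` vertex operators. -/
def ComposableWith (A : MOSVA V) (B : Bimod A W) (n m : ℕ)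
    (Φ : (Fin n → V) → (Fin n → ℂ) → B.gr.Comp) : Prop :=
  ∃ Cb : V → V → ℕ,
  ∀ (α : Fin (n+1) → ℕ), (∑ i, α i) = m + n →
  ∀ l₀ : ℕ, l₀ ≤ α 0 →
  ∀ u : (i : Fin (n+1)) → Fin (α i) → V,
  ∀ φ : W →ₗ[ℂ] ℂ, InGradedDual B.gr.proj φ →
  ∃ R : DiagRatFn ((i : Fin (n+1)) × Fin (α i)),
    (∀ q q' : (i : Fin (n+1)) × Fin (α i), R.b q q' ≤ Cb (u q.1 q.2) (u q'.1 q'.2)) ∧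
    ∀ (z : (i : Fin (n+1)) → Fin (α i) → ℂ) (ζ : Fin n → ℂ),
      (∀ s t : Fin (α 0), s < t → ‖z 0 t‖ < ‖z 0 s‖) →
      (∀ (j : Fin (α 0)) (i : Fin n) (t : Fin (α i.succ)),
          ‖ζ i‖ + ‖z i.succ t - ζ i‖ < ‖z 0 j‖) →
      (∀ (i : Fin n) (s t : Fin (α i.succ)), s < t →
          ‖z i.succ t - ζ i‖ < ‖z i.succ s - ζ i‖) →
      (∀ (i j : Fin n), i < j → ∀ (s : Fin (α i.succ)) (t : Fin (α j.succ)),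
          ‖(z i.succ s - ζ i) - (z j.succ t - ζ j)‖ < ‖ζ i - ζ j‖) →
      AbsConvTo (fun K : (i : Fin (n+1)) → Fin (α i) → ℤ =>
          B.gr.pair φ
            (compApply (α 0) (fun j => B.gr.ext (fun x =>
                if (j : ℕ) < l₀ then B.YL (u 0 j) x (K 0 j) else B.YsR (u 0 j) x (K 0 j)))
              (Φ (fun i => compApply (α i.succ)
                    (fun s x => A.Y (u i.succ s) x (K i.succ s)) A.vac) ζ))
            * (∏ j, z 0 j ^ (-(K 0 j) - 1))
            * ∏ i : Fin n, ∏ s, (z i.succ s - ζ i) ^ (-(K i.succ s) - 1))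
        (R.eval (fun q => z q.1 q.2))

/-- The set `Ĉ^n_m(V,W)`: maps `V^{⊗n} → W̃_{z₁,…,zₙ}` that are linear, satisfy the
`D`-derivative and `d`-conjugation properties and are composable with `m` vertex
operators. -/
def IsCochain (A : MOSVA V) (B : Bimod A W) (n m : ℕ)
    (Φ : (Fin n → V) → (Fin n → ℂ) → B.gr.Comp) : Prop :=
  IsMultilinear Φ ∧ (∀ v, B.gr.WTilde (Φ v)) ∧ DDerivProp A B Φ ∧ DConjProp A B Φ ∧
    ComposableWith A B n m Φ

/-- `Ψ` represents `E_W^{(1,0)} ∘₂ Φ`, i.e. the map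
`v ↦ E(Y_W^L(v 0, z 0) Φ(v 1 ⊗ ⋯ ⊗ v n)(z 1,…,z n))`. -/
def RepLeft (A : MOSVA V) (B : Bimod A W) {n : ℕ}
    (Φ : (Fin n → V) → (Fin n → ℂ) → B.gr.Comp)
    (Ψ : (Fin (n+1) → V) → (Fin (n+1) → ℂ) → B.gr.Comp) : Prop :=
  (∀ v, B.gr.WTilde (Ψ v)) ∧
  ∀ (v : Fin (n+1) → V) (φ : W →ₗ[ℂ] ℂ), InGradedDual B.gr.proj φ →
    ∀ (z₀ : ℂ) (zt : Fin n → ℂ), Conf (Fin.cons z₀ zt) →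
      (∀ i, ‖zt i‖ < ‖z₀‖) → (∀ i, 0 < ‖zt i‖) →
      AbsConvTo (fun k : ℤ =>
          B.gr.pair φ (B.gr.ext (fun x => B.YL (v 0) x k) (Φ (Fin.tail v) zt))
            * z₀ ^ (-k - 1))
        (B.gr.pair φ (Ψ v (Fin.cons z₀ zt)))

/-- `Ψ` represents `E_W^{(0,1)} ∘₂ Φ`, i.e. the map
`v ↦ E(Y_W^{s(R)}(v (n+1), z (n+1)) Φ(v 1 ⊗ ⋯ ⊗ v n)(z 1,…,z n))`. -/
def RepRight (A : MOSVA V) (B : Bimod A W) {n : ℕ}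
    (Φ : (Fin n → V) → (Fin n → ℂ) → B.gr.Comp)
    (Ψ : (Fin (n+1) → V) → (Fin (n+1) → ℂ) → B.gr.Comp) : Prop :=
  (∀ v, B.gr.WTilde (Ψ v)) ∧
  ∀ (v : Fin (n+1) → V) (φ : W →ₗ[ℂ] ℂ), InGradedDual B.gr.proj φ →
    ∀ (zl : ℂ) (zi : Fin n → ℂ), Conf (Fin.snoc zi zl) →
      (∀ i, ‖zi i‖ < ‖zl‖) → (∀ i, 0 < ‖zi i‖) →
      AbsConvTo (fun k : ℤ =>
          B.gr.pair φ (B.gr.ext (fun x => B.YsR (v (Fin.last n)) x k) (Φ (Fin.init v) zi))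
            * zl ^ (-k - 1))
        (B.gr.pair φ (Ψ v (Fin.snoc zi zl)))

/-- Replace the two adjacent entries `i, i+1` of an `(n+1)`-tuple by a single entry. -/
def mergeAt {M : Type*} {n : ℕ} (i : Fin n) (v : Fin (n+1) → M) (a : M) : Fin n → M :=
  fun j => if j < i then v j.castSucc else if j = i then a else v j.succ

/-- `Ψ` represents `Φ ∘ᵢ E_V^{(2)}`, i.e. the map
`v ↦ E(Φ(v 1 ⊗ ⋯ ⊗ Y_V(v i, z i − ζ)Y_V(v (i+1), z (i+1) − ζ)𝟏 ⊗ ⋯ ⊗ v (n+1))(…,ζ,…))`. -/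
def RepCirc (A : MOSVA V) (B : Bimod A W) {n : ℕ} (i : Fin n)
    (Φ : (Fin n → V) → (Fin n → ℂ) → B.gr.Comp)
    (Ψ : (Fin (n+1) → V) → (Fin (n+1) → ℂ) → B.gr.Comp) : Prop :=
  (∀ v, B.gr.WTilde (Ψ v)) ∧
  ∀ (v : Fin (n+1) → V) (φ : W →ₗ[ℂ] ℂ), InGradedDual B.gr.proj φ →
    ∀ (z : Fin (n+1) → ℂ) (ζ : ℂ), Conf z → Conf (mergeAt i z ζ) →
      ‖z i.succ - ζ‖ < ‖z i.castSucc - ζ‖ → 0 < ‖z i.succ - ζ‖ →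
      (∀ j : Fin (n+1), j ≠ i.castSucc → j ≠ i.succ →
        ‖z i.castSucc - ζ‖ < ‖z j - z i.castSucc‖ ∧ ‖z i.succ - ζ‖ < ‖z j - z i.succ‖) →
      AbsConvTo (fun k : ℤ × ℤ =>
          B.gr.pair φ
            (Φ (mergeAt i v (A.Y (v i.castSucc) (A.Y (v i.succ) A.vac k.2) k.1))
              (mergeAt i z ζ))
            * (z i.castSucc - ζ) ^ (-k.1 - 1) * (z i.succ - ζ) ^ (-k.2 - 1))
        (B.gr.pair φ (Ψ v z))

/-- `Ψ` represents the coboundary `δ̂Φ = E_W^{(1,0)}∘₂Φ + Σᵢ (−1)^i Φ∘ᵢE_V^{(2)}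
+ (−1)^{n+1} E_W^{(0,1)}∘₂Φ` of the `n`-cochain `Φ`. -/
def IsDelta (A : MOSVA V) (B : Bimod A W) {n : ℕ}
    (Φ : (Fin n → V) → (Fin n → ℂ) → B.gr.Comp)
    (Ψ : (Fin (n+1) → V) → (Fin (n+1) → ℂ) → B.gr.Comp) : Prop :=
  ∃ (gL gR : (Fin (n+1) → V) → (Fin (n+1) → ℂ) → B.gr.Comp)
    (gC : Fin n → (Fin (n+1) → V) → (Fin (n+1) → ℂ) → B.gr.Comp),
    RepLeft A B Φ gL ∧ RepRight A B Φ gR ∧ (∀ i, RepCirc A B i Φ (gC i)) ∧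
    ∀ v z, Ψ v z = gL v z + (∑ i : Fin n, ((-1 : ℂ) ^ ((i : ℕ) + 1)) • gC i v z)
      + ((-1 : ℂ) ^ (n + 1)) • gR v z

end Cochains

/-! ### Doubly infinite Laurent series in two variables -/

theorem absConvTo_iff {ι : Type*} {f : ι → ℂ} {s : ℂ} : AbsConvTo f s ↔ HasSum f s :=
  ⟨fun h => h.2, fun h => ⟨h.summable.norm, h⟩⟩

theorem HasSum.of_eq {ι : Type*} {f g : ι → ℂ} {s : ℂ} (h : HasSum f s) (hfg : ∀ i, g i = f i) :
    HasSum g s := by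
  rwa [funext hfg]

/-- Coefficient arrays of doubly infinite Laurent series; the entry at `k` is the coefficient
of `z₁ ^ (-k.1 - 1) * z₂ ^ (-k.2 - 1)`. -/
abbrev Arr := ℤ × ℤ → ℂ

/-- The series with coefficient array `c` converges absolutely to `s` at `(z₁, z₂)`. -/
def Ser (c : Arr) (z₁ z₂ s : ℂ) : Prop :=
  HasSum (fun k : ℤ × ℤ => c k * z₁ ^ (-k.1 - 1) * z₂ ^ (-k.2 - 1)) s

/-- Only nonnegative powers of the first variable occur. -/
def Van (c : Arr) : Prop := ∀ k : ℤ × ℤ, 0 ≤ k.1 → c k = 0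

theorem coeff_eq_zero_of_hasSum_circle {c : ℤ → ℂ} {ρ : ℝ} (hρ : 0 < ρ)
    (h : ∀ z : ℂ, ‖z‖ = ρ → HasSum (fun k : ℤ => c k * z ^ (-k - 1)) 0) (m : ℤ) : c m = 0 := by
  have hn : ∀ θ : ℝ, ‖circleMap 0 ρ θ‖ = ρ := fun θ => by
    rw [norm_circleMap_zero, abs_of_pos hρ]
  have hne : ∀ θ : ℝ, circleMap 0 ρ θ ≠ 0 := fun θ => circleMap_ne_center hρ.ne'
  have hs : Summable fun k : ℤ => ‖c k‖ * ρ ^ (-k - 1) := by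
    have := (h ρ (by simp [abs_of_pos hρ])).summable.norm
    simpa [norm_mul, norm_zpow, abs_of_pos hρ] using this
  have key : HasSum (fun k : ℤ => ∮ z in C((0 : ℂ), ρ), c k * z ^ (m - k - 1))
      (∫ _ in (0 : ℝ)..2 * Real.pi, (0 : ℂ)) := by
    unfold circleIntegral
    refine intervalIntegral.hasSum_integral_of_dominated_convergence
      (fun k _ => ‖c k‖ * ρ ^ (-k - 1) * ρ ^ (m + 1)) ?_ ?_ ?_ ?_ ?_
    · intro k
      refine Continuous.aestronglyMeasurable ?_
      simp only [deriv_circleMap]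
      refine Continuous.smul ((continuous_circleMap 0 ρ).mul continuous_const) (Continuous.mul continuous_const ?_)
      exact Continuous.zpow₀ (continuous_circleMap 0 ρ) _ (fun θ => Or.inl (hne θ))
    · intro k
      refine Filter.Eventually.of_forall fun θ _ => ?_
      rw [deriv_circleMap, smul_eq_mul, norm_mul, norm_mul, norm_mul, norm_zpow, hn]
      simp only [Complex.norm_I, mul_one]
      rw [show ρ * (‖c k‖ * ρ ^ (m - k - 1)) = ‖c k‖ * (ρ ^ (1:ℤ) * ρ ^ (m - k - 1)) by
        rw [zpow_one]; ring, ← zpow_add₀ hρ.ne', mul_assoc, ← zpow_add₀ hρ.ne']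
      ring_nf
      exact le_rfl
    · exact Filter.Eventually.of_forall fun θ _ => hs.mul_right _
    · exact intervalIntegrable_const
    · refine Filter.Eventually.of_forall fun θ _ => ?_
      have := ((h _ (hn θ)).mul_right ((circleMap 0 ρ θ) ^ m)).mul_left
        (deriv (circleMap 0 ρ) θ)
      simp only [zero_mul, mul_zero] at this
      refine HasSum.of_eq this fun k => ?_
      rw [smul_eq_mul, mul_assoc (c k), ← zpow_add₀ (hne θ)]
      ring_nf
  rw [intervalIntegral.integral_zero] at key
  have hv : ∀ k : ℤ, k ≠ m → (∮ z in C((0 : ℂ), ρ), c k * z ^ (m - k - 1)) = 0 := by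
    intro k hk
    rw [circleIntegral.integral_const_mul]
    have := circleIntegral.integral_sub_zpow_of_ne (n := m - k - 1) (by omega) 0 0 ρ
    simp only [sub_zero] at this
    rw [this, mul_zero]
  have h1 := (hasSum_single m hv).unique key
  rw [circleIntegral.integral_const_mul] at h1
  have h2 := circleIntegral.integral_sub_center_inv (0 : ℂ) hρ.ne'
  simp only [sub_zero] at h2
  simp only [sub_self, zero_sub, zpow_neg_one, h2] at h1
  rcases mul_eq_zero.1 h1 with h3 | h3
  · exact h3
  · exact absurd h3 Complex.two_pi_I_ne_zero

theorem Ser.coeff_eq_zero {c : Arr} {ρ₁ ρ₂ : ℝ} (h₁ : 0 < ρ₁) (h₂ : 0 < ρ₂)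
    (h : ∀ z₁ z₂ : ℂ, ‖z₁‖ = ρ₁ → ‖z₂‖ = ρ₂ → Ser c z₁ z₂ 0) : c = 0 := by
  have hne : ∀ {z : ℂ} {ρ : ℝ}, 0 < ρ → ‖z‖ = ρ → z ≠ 0 := fun h0 h1 h2 => by
    rw [h2, norm_zero] at h1; exact h0.ne h1
  have hfib : ∀ z₂ : ℂ, ‖z₂‖ = ρ₂ → ∀ k₁ : ℤ,
      Summable (fun k₂ : ℤ => c (k₁, k₂) * z₂ ^ (-k₂ - 1)) := by
    intro z₂ hz₂ k₁
    have hz₁ : ‖(ρ₁ : ℂ)‖ = ρ₁ := by simp [abs_of_pos h₁]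
    have := (h ρ₁ z₂ hz₁ hz₂).summable.prod_factor k₁
    have h3 := this.mul_left (((ρ₁ : ℂ) ^ (-k₁ - 1))⁻¹)
    refine h3.congr fun k₂ => ?_
    have h4 : (ρ₁ : ℂ) ^ (-k₁ - 1) ≠ 0 := zpow_ne_zero _ (hne h₁ hz₁)
    field_simp
  have h5 : ∀ z₂ : ℂ, ‖z₂‖ = ρ₂ → ∀ k₁ : ℤ, ∑' k₂ : ℤ, c (k₁, k₂) * z₂ ^ (-k₂ - 1) = 0 := by
    intro z₂ hz₂
    refine coeff_eq_zero_of_hasSum_circle h₁ fun z₁ hz₁ => ?_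
    refine (h z₁ z₂ hz₁ hz₂).prod_fiberwise fun k₁ => ?_
    have := (hfib z₂ hz₂ k₁).hasSum.mul_right (z₁ ^ (-k₁ - 1))
    exact HasSum.of_eq this fun k₂ => by ring
  funext k
  refine coeff_eq_zero_of_hasSum_circle (c := fun k₂ => c (k.1, k₂)) h₂ (fun z₂ hz₂ => ?_) k.2
  rw [← h5 z₂ hz₂ k.1]
  exact (hfib z₂ hz₂ k.1).hasSum

theorem Ser.sub {c d : Arr} {z₁ z₂ s t : ℂ} (hc : Ser c z₁ z₂ s) (hd : Ser d z₁ z₂ t) :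
    Ser (c - d) z₁ z₂ (s - t) := by
  unfold Ser at *
  exact HasSum.of_eq (HasSum.sub hc hd) fun k => by simp only [Pi.sub_apply]; ring

theorem Ser.add {c d : Arr} {z₁ z₂ s t : ℂ} (hc : Ser c z₁ z₂ s) (hd : Ser d z₁ z₂ t) :
    Ser (c + d) z₁ z₂ (s + t) := by
  unfold Ser at *
  exact HasSum.of_eq (HasSum.add hc hd) fun k => by simp only [Pi.add_apply]; ring

theorem Ser.smul {c : Arr} {z₁ z₂ s : ℂ} (a : ℂ) (hc : Ser c z₁ z₂ s) :
    Ser (a • c) z₁ z₂ (a * s) := by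
  unfold Ser at *
  exact HasSum.of_eq (hc.mul_left a) fun k => by simp only [Pi.smul_apply, smul_eq_mul]; ring

/-- Uniqueness of double Laurent expansions on a torus. -/
theorem Ser.ext {c d : Arr} {ρ₁ ρ₂ : ℝ} (h₁ : 0 < ρ₁) (h₂ : 0 < ρ₂)
    (h : ∀ z₁ z₂ : ℂ, ‖z₁‖ = ρ₁ → ‖z₂‖ = ρ₂ → ∃ s, Ser c z₁ z₂ s ∧ Ser d z₁ z₂ s) :
    c = d := by
  refine sub_eq_zero.1 (Ser.coeff_eq_zero h₁ h₂ fun z₁ z₂ hz₁ hz₂ => ?_)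
  obtain ⟨s, hc, hd⟩ := h z₁ z₂ hz₁ hz₂
  simpa using hc.sub hd

/-- The reindexing used to multiply a double series by a series of monomials. -/
def smearEquiv (σ τ : ℕ → ℤ) : (ℤ × ℤ) × ℕ ≃ ℕ × (ℤ × ℤ) where
  toFun x := (x.2, (x.1.1 + σ x.2, x.1.2 + τ x.2))
  invFun y := ((y.2.1 - σ y.1, y.2.2 - τ y.1), y.1)
  left_inv x := by
    obtain ⟨⟨a, b⟩, j⟩ := x
    exact Prod.ext (Prod.ext (add_sub_cancel_right _ _) (add_sub_cancel_right _ _)) rfl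
  right_inv y := by
    obtain ⟨j, a, b⟩ := y
    exact Prod.ext rfl (Prod.ext (sub_add_cancel _ _) (sub_add_cancel _ _))

theorem zpow_shift_aux {z : ℂ} {k σ : ℤ} {x : ℂ} (h : z ≠ 0 ∨ ((0 ≤ k + σ → x = 0) ∧ 0 ≤ σ)) :
    x * z ^ (-k - 1) = x * (z ^ σ * z ^ (-(k + σ) - 1)) := by
  by_cases hz : z = 0
  · obtain ⟨h1, h2⟩ := h.resolve_left (not_not.2 hz)
    by_cases hk : 0 ≤ k + σ
    · simp [h1 hk]
    · rcases h2.eq_or_lt with h3 | h3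
      · simp [← h3]
      · rw [hz, zero_zpow _ (by omega : -k - 1 ≠ 0), zero_zpow σ (by omega), zero_mul]
  · rw [← zpow_add₀ hz]; congr 2; ring

/-- Multiplication of a double Laurent series by an absolutely convergent series of monomials. -/
theorem Ser.smear {c : Arr} {z₁ z₂ s : ℂ} (hc : Ser c z₁ z₂ s) {e : ℕ → ℂ} {σ τ : ℕ → ℤ} {E : ℂ}
    (hE : HasSum (fun j => e j * z₁ ^ σ j * z₂ ^ τ j) E) (hz₂ : z₂ ≠ 0)
    (hz₁ : z₁ ≠ 0 ∨ (Van c ∧ ∀ j, 0 ≤ σ j)) :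
    Ser (fun k => ∑' j, e j * c (k.1 + σ j, k.2 + τ j)) z₁ z₂ (E * s) := by
  have h0 := summable_mul_of_summable_norm (f := fun j => e j * z₁ ^ σ j * z₂ ^ τ j)
    (g := fun k : ℤ × ℤ => c k * z₁ ^ (-k.1 - 1) * z₂ ^ (-k.2 - 1))
    hE.summable.norm hc.summable.norm
  have h1 := HasSum.mul hE hc h0
  rw [← (smearEquiv σ τ).hasSum_iff] at h1
  have h2 : ((fun x : ℕ × (ℤ × ℤ) => (e x.1 * z₁ ^ σ x.1 * z₂ ^ τ x.1) *
      (c x.2 * z₁ ^ (-x.2.1 - 1) * z₂ ^ (-x.2.2 - 1))) ∘ smearEquiv σ τ) =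
      fun x : (ℤ × ℤ) × ℕ => e x.2 * c (x.1.1 + σ x.2, x.1.2 + τ x.2) *
        (z₁ ^ (-x.1.1 - 1) * z₂ ^ (-x.1.2 - 1)) := by
    funext x
    have a1 := zpow_shift_aux (z := z₁) (k := x.1.1) (σ := σ x.2)
      (x := c (x.1.1 + σ x.2, x.1.2 + τ x.2))
      (hz₁.imp id fun h => ⟨fun h' => h.1 _ h', h.2 _⟩)
    have a2 := zpow_shift_aux (z := z₂) (k := x.1.2) (σ := τ x.2) (x := 1) (Or.inl hz₂)
    rw [one_mul, one_mul] at a2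
    simp only [Function.comp, smearEquiv, Equiv.coe_fn_mk]
    linear_combination (-(e x.2) * z₂ ^ (-x.1.2 - 1)) * a1
      - (e x.2 * c (x.1.1 + σ x.2, x.1.2 + τ x.2)
          * (z₁ ^ σ x.2 * z₁ ^ (-(x.1.1 + σ x.2) - 1))) * a2
  rw [h2] at h1
  unfold Ser
  refine h1.prod_fiberwise fun k => ?_
  have h3 := (h1.summable.prod_factor k).hasSum
  dsimp only at h3 ⊢
  rw [tsum_mul_right, ← mul_assoc] at h3
  exact h3

/-- Multiplication by the monomial `z₁ ^ a * z₂ ^ b`. -/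
def sh (a b : ℤ) : Module.End ℂ Arr := LinearMap.funLeft ℂ ℂ fun k => (k.1 + a, k.2 + b)

@[simp] theorem sh_apply (a b : ℤ) (c : Arr) (k : ℤ × ℤ) : sh a b c k = c (k.1 + a, k.2 + b) := rfl

/-- Multiplication by `z₁ - z₂`. -/
def mulSub : Module.End ℂ Arr := sh 1 0 - sh 0 1

/-- Multiplication by `z₁ + z₂`. -/
def mulAdd : Module.End ℂ Arr := sh 1 0 + sh 0 1

theorem mulSub_apply (c : Arr) (k : ℤ × ℤ) :
    mulSub c k = c (k.1 + 1, k.2) - c (k.1, k.2 + 1) := by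
  simp [mulSub]

theorem mulAdd_apply (c : Arr) (k : ℤ × ℤ) :
    mulAdd c k = c (k.1 + 1, k.2) + c (k.1, k.2 + 1) := by
  simp [mulAdd]

theorem sh_injective (a b : ℤ) : Function.Injective (sh a b) := by
  intro c d h
  funext k
  have := congrFun h (k.1 - a, k.2 - b)
  simpa using this

theorem sh_pow (a b : ℤ) (n : ℕ) : sh a b ^ n = sh (n * a) (n * b) := by
  induction n with
  | zero => ext c k; simp
  | succ n ih =>
    ext c k
    rw [pow_succ, ih]
    simp only [Module.End.mul_apply, sh_apply, Nat.cast_add, Nat.cast_one]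
    ring_nf

theorem Ser.sh {c : Arr} {z₁ z₂ s : ℂ} (hc : Ser c z₁ z₂ s) (a b : ℤ) (hz₂ : z₂ ≠ 0)
    (hz₁ : z₁ ≠ 0 ∨ (Van c ∧ 0 ≤ a)) : Ser (VA.sh a b c) z₁ z₂ (z₁ ^ a * z₂ ^ b * s) := by
  have h1 : HasSum (fun j : ℕ => (if j = 0 then (1 : ℂ) else 0) * z₁ ^ a * z₂ ^ b)
      (z₁ ^ a * z₂ ^ b) := by
    refine HasSum.of_eq (hasSum_ite_eq 0 (z₁ ^ a * z₂ ^ b)) fun j => ?_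
    split_ifs <;> simp
  have h2 := hc.smear (σ := fun _ => a) (τ := fun _ => b) h1 hz₂ (hz₁.imp id fun h => ⟨h.1, fun _ => h.2⟩)
  refine HasSum.of_eq h2 fun k => ?_
  simp [tsum_ite_eq]

theorem Van.sh {c : Arr} (h : Van c) {a : ℤ} (ha : 0 ≤ a) (b : ℤ) : Van (VA.sh a b c) :=
  fun k hk => h _ (by simpa using by omega)

theorem Ser.mulSub {c : Arr} {z₁ z₂ s : ℂ} (hc : Ser c z₁ z₂ s) (h₁ : z₁ ≠ 0) (h₂ : z₂ ≠ 0) :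
    Ser (VA.mulSub c) z₁ z₂ ((z₁ - z₂) * s) := by
  have := (hc.sh 1 0 h₂ (Or.inl h₁)).sub (hc.sh 0 1 h₂ (Or.inl h₁))
  simp only [zpow_one, zpow_zero, one_mul, mul_one, ← sub_mul] at this
  exact this

theorem Ser.mulAdd {c : Arr} {z₁ z₂ s : ℂ} (hc : Ser c z₁ z₂ s) (h₁ : z₁ ≠ 0) (h₂ : z₂ ≠ 0) :
    Ser (VA.mulAdd c) z₁ z₂ ((z₁ + z₂) * s) := by
  have := (hc.sh 1 0 h₂ (Or.inl h₁)).add (hc.sh 0 1 h₂ (Or.inl h₁))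
  simp only [zpow_one, zpow_zero, one_mul, mul_one, ← add_mul] at this
  exact this

theorem Ser.mulSub_pow {c : Arr} {z₁ z₂ s : ℂ} (hc : Ser c z₁ z₂ s) (h₁ : z₁ ≠ 0) (h₂ : z₂ ≠ 0)
    (n : ℕ) : Ser ((VA.mulSub ^ n) c) z₁ z₂ ((z₁ - z₂) ^ n * s) := by
  induction n with
  | zero => simpa using hc
  | succ n ih =>
    have := ih.mulSub h₁ h₂
    rwa [← mul_assoc, ← pow_succ', ← Module.End.mul_apply, ← pow_succ'] at this

theorem Ser.mulAdd_pow {c : Arr} {z₁ z₂ s : ℂ} (hc : Ser c z₁ z₂ s) (h₁ : z₁ ≠ 0) (h₂ : z₂ ≠ 0)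
    (n : ℕ) : Ser ((VA.mulAdd ^ n) c) z₁ z₂ ((z₁ + z₂) ^ n * s) := by
  induction n with
  | zero => simpa using hc
  | succ n ih =>
    have := ih.mulAdd h₁ h₂
    rwa [← mul_assoc, ← pow_succ', ← Module.End.mul_apply, ← pow_succ'] at this

/-- In each total degree only powers of `z₁` bounded below occur. -/
def DiagTrunc (c : Arr) : Prop :=
  ∀ N : ℤ, ∃ K : ℤ, ∀ k : ℤ × ℤ, k.1 + k.2 = N → K ≤ k.1 → c k = 0

theorem DiagTrunc.mulSub {c : Arr} (h : DiagTrunc c) : DiagTrunc (VA.mulSub c) := by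
  intro N
  obtain ⟨K, hK⟩ := h (N + 1)
  refine ⟨K, fun k hk hKk => ?_⟩
  rw [mulSub_apply, hK (k.1 + 1, k.2) (by simp only; omega) (by simp only; omega),
    hK (k.1, k.2 + 1) (by simp only; omega) (by simpa using hKk), sub_zero]

theorem DiagTrunc.eq_tsum {c : Arr} (h : DiagTrunc c) (k : ℤ × ℤ) :
    c k = ∑' j : ℕ, (-1 : ℂ) * VA.mulSub c (k.1 + (j : ℤ), k.2 + (-1 - (j : ℤ))) := by
  obtain ⟨K, hK⟩ := h (k.1 + k.2)
  have h0 : ∀ j : ℕ, (K - k.1).toNat ≤ j → c (k.1 + j, k.2 - j) = 0 := fun j hj =>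
    hK _ (by simp) (by simp only; omega)
  have h1 : ∀ j : ℕ, (-1 : ℂ) * VA.mulSub c (k.1 + (j : ℤ), k.2 + (-1 - (j : ℤ))) =
      c (k.1 + j, k.2 - j) - c (k.1 + (j + 1 : ℕ), k.2 - (j + 1 : ℕ)) := by
    intro j
    rw [mulSub_apply]
    have e1 : k.1 + (j : ℤ) + 1 = k.1 + (j + 1 : ℕ) := by push_cast; ring
    have e2 : k.2 + (-1 - (j : ℤ)) = k.2 - (j + 1 : ℕ) := by push_cast; ring
    have e3 : k.2 - ((j + 1 : ℕ) : ℤ) + 1 = k.2 - j := by push_cast; ring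
    simp only [e1, e2, e3]
    ring
  simp_rw [h1]
  rw [tsum_eq_sum (s := Finset.range (K - k.1).toNat), Finset.sum_range_sub', h0 _ le_rfl]
  · simp
  · intro j hj
    rw [Finset.mem_range, not_lt] at hj
    rw [h0 j hj, h0 (j + 1) (by omega), sub_zero]

theorem DiagTrunc.van {c : Arr} (h : DiagTrunc c) (hv : Van (VA.mulSub c)) : Van c := by
  intro k hk
  rw [h.eq_tsum k]
  have : ∀ j : ℕ, (-1 : ℂ) * VA.mulSub c (k.1 + (j : ℤ), k.2 + (-1 - (j : ℤ))) = 0 := fun j => by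
    rw [hv _ (by simp only; omega), mul_zero]
  simp [this]

theorem DiagTrunc.van_of_pow {n : ℕ} {c : Arr} (h : DiagTrunc c) (hv : Van ((VA.mulSub ^ n) c)) :
    Van c := by
  induction n generalizing c with
  | zero => simpa using hv
  | succ n ih =>
    rw [pow_succ, Module.End.mul_apply] at hv
    exact h.van (ih h.mulSub hv)

/-- Division of a double series by `z₁ - z₂`, expanded in the region `|z₁| < |z₂|`. -/
theorem Ser.of_mulSub {c : Arr} {z₁ z₂ s : ℂ} (h : Ser (VA.mulSub c) z₁ z₂ s) (htr : DiagTrunc c)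
    (hlt : ‖z₁‖ < ‖z₂‖) (hz₁ : z₁ ≠ 0 ∨ Van (VA.mulSub c)) : Ser c z₁ z₂ (s / (z₁ - z₂)) := by
  have h₂ : z₂ ≠ 0 := norm_pos_iff.1 ((norm_nonneg _).trans_lt hlt)
  have hne : z₁ - z₂ ≠ 0 := sub_ne_zero.2 fun e => hlt.ne (by rw [e])
  have hE : HasSum (fun j : ℕ => (-1 : ℂ) * z₁ ^ (j : ℤ) * z₂ ^ (-1 - (j : ℤ)))
      ((z₁ - z₂)⁻¹) := by
    have h1 : ‖z₁ / z₂‖ < 1 := by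
      rw [norm_div, div_lt_one (norm_pos_iff.2 h₂)]; exact hlt
    have h2 := (hasSum_geometric_of_norm_lt_one h1).mul_left (-z₂⁻¹)
    have h3 : -z₂⁻¹ * (1 - z₁ / z₂)⁻¹ = (z₁ - z₂)⁻¹ := by
      rw [← inv_neg, ← mul_inv]
      congr 1
      field_simp
      ring
    rw [h3] at h2
    refine HasSum.of_eq h2 fun j => ?_
    rw [zpow_sub₀ h₂, zpow_natCast, zpow_natCast, zpow_neg_one, div_pow]
    ring
  have h4 := h.smear (σ := fun j => (j : ℤ)) (τ := fun j => -1 - (j : ℤ)) hE h₂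
    (hz₁.imp id fun h => ⟨h, fun j => by positivity⟩)
  rw [inv_mul_eq_div] at h4
  exact HasSum.of_eq h4 fun k => by rw [htr.eq_tsum k]

theorem Ser.of_mulSub_pow {n : ℕ} {c : Arr} {z₁ z₂ s : ℂ} (h : Ser ((VA.mulSub ^ n) c) z₁ z₂ s)
    (htr : DiagTrunc c) (hlt : ‖z₁‖ < ‖z₂‖) (hz₁ : z₁ ≠ 0 ∨ Van ((VA.mulSub ^ n) c)) :
    Ser c z₁ z₂ (s / (z₁ - z₂) ^ n) := by
  induction n generalizing c with
  | zero => simpa using h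
  | succ n ih =>
    rw [pow_succ, Module.End.mul_apply] at h hz₁
    have h1 := ih h htr.mulSub hz₁
    have h2 := h1.of_mulSub htr hlt (hz₁.imp id fun hv => htr.mulSub.van_of_pow hv)
    rwa [div_div, ← pow_succ] at h2

/-- The value of `mulSub ^ n` at `k` depends only on the entries of total degree `k.1 + k.2 + n`. -/
theorem mulSub_pow_congr {n : ℕ} {c d : Arr} {k : ℤ × ℤ}
    (h : ∀ l : ℤ × ℤ, l.1 + l.2 = k.1 + k.2 + n → c l = d l) :
    (mulSub ^ n) c k = (mulSub ^ n) d k := by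
  induction n generalizing k with
  | zero => simpa using h k (by simp)
  | succ n ih =>
    rw [pow_succ', Module.End.mul_apply, Module.End.mul_apply, mulSub_apply, mulSub_apply]
    rw [@ih (k.1 + 1, k.2), @ih (k.1, k.2 + 1)]
    all_goals
      intro l hl
      refine h l ?_
      simp only at hl
      push_cast
      omega

/-! ### The substitution `z₁ ↦ z₁ + z₂` -/

/-- Only powers of `z₂` bounded below occur. -/
def Trunc (c : Arr) : Prop := ∃ N : ℤ, ∀ k : ℤ × ℤ, N ≤ k.2 → c k = 0

theorem Trunc.sh {c : Arr} (h : Trunc c) (a b : ℤ) : Trunc (VA.sh a b c) := by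
  obtain ⟨N, hN⟩ := h
  exact ⟨N - b, fun k hk => hN _ (by simp only; omega)⟩

theorem Trunc.add {c d : Arr} (hc : Trunc c) (hd : Trunc d) : Trunc (c + d) := by
  obtain ⟨N, hN⟩ := hc
  obtain ⟨M, hM⟩ := hd
  refine ⟨max N M, fun k hk => ?_⟩
  rw [Pi.add_apply, hN k (le_of_max_le_left hk), hM k (le_of_max_le_right hk), add_zero]

theorem Trunc.sub {c d : Arr} (hc : Trunc c) (hd : Trunc d) : Trunc (c - d) := by
  obtain ⟨N, hN⟩ := hc
  obtain ⟨M, hM⟩ := hd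
  refine ⟨max N M, fun k hk => ?_⟩
  rw [Pi.sub_apply, hN k (le_of_max_le_left hk), hM k (le_of_max_le_right hk), sub_zero]

theorem Trunc.mulSub {c : Arr} (h : Trunc c) : Trunc (VA.mulSub c) := (h.sh 1 0).sub (h.sh 0 1)

/-- The substitution `z₁ ↦ z₁ + z₂`, expanded in nonnegative powers of `z₂`. -/
def subst (c : Arr) : Arr := fun k =>
  ∑ᶠ j : ℕ, ((-1 : ℂ) ^ j * (Ring.choose k.1 j : ℤ)) * c (k.1 - j, k.2 + j)

theorem subst_eq {c : Arr} {N : ℤ} (h : ∀ k : ℤ × ℤ, N ≤ k.2 → c k = 0) (k : ℤ × ℤ) {J : ℕ}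
    (hJ : N ≤ k.2 + J) :
    subst c k = ∑ j ∈ Finset.range J, ((-1 : ℂ) ^ j * (Ring.choose k.1 j : ℤ)) *
      c (k.1 - j, k.2 + j) := by
  refine finsum_eq_sum_of_support_subset _ fun j hj => ?_
  by_contra hj'
  simp only [Finset.coe_range, Set.mem_Iio, not_lt] at hj'
  refine hj ?_
  show _ * c (k.1 - j, k.2 + j) = 0
  rw [h _ (by simp only; omega), mul_zero]

theorem subst_add {c d : Arr} (hc : Trunc c) (hd : Trunc d) :
    subst (c + d) = subst c + subst d := by
  have hcd := hc.add hd
  obtain ⟨N, hN⟩ := hc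
  obtain ⟨M, hM⟩ := hd
  obtain ⟨L, hL⟩ := hcd
  funext k
  obtain ⟨J, hJ⟩ : ∃ J : ℕ, max N (max M L) ≤ k.2 + J :=
    ⟨(max N (max M L) - k.2).toNat, by omega⟩
  rw [Pi.add_apply, subst_eq hN k (J := J) (by omega), subst_eq hM k (J := J) (by omega),
    subst_eq hL k (J := J) (by omega), ← Finset.sum_add_distrib]
  exact Finset.sum_congr rfl fun j _ => by rw [Pi.add_apply, mul_add]

theorem subst_sub {c d : Arr} (hc : Trunc c) (hd : Trunc d) :
    subst (c - d) = subst c - subst d := by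
  have := subst_add (hc.sub hd) hd
  rw [sub_add_cancel] at this
  rw [this, add_sub_cancel_right]

theorem subst_sh_snd (c : Arr) (b : ℤ) : subst (sh 0 b c) = sh 0 b (subst c) := by
  funext k
  simp only [subst, sh_apply, add_zero]
  exact finsum_congr fun j => by rw [add_right_comm]

theorem subst_sh_fst {c : Arr} (hc : Trunc c) : subst (sh 1 0 c) = mulAdd (subst c) := by
  obtain ⟨N, hN⟩ := hc
  funext k
  obtain ⟨J, hJ⟩ : ∃ J : ℕ, N ≤ k.2 + J := ⟨(N - k.2).toNat, by omega⟩
  have hs : ∀ l : ℤ × ℤ, N ≤ l.2 → sh 1 0 c l = 0 := fun l hl => hN _ (by simpa using hl)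
  rw [mulAdd_apply, subst_eq hs k (J := J + 1) (by push_cast; omega),
    subst_eq hN (k.1 + 1, k.2) (J := J + 1) (by push_cast; omega),
    subst_eq hN (k.1, k.2 + 1) (J := J) (by simp only; omega),
    Finset.sum_range_succ', Finset.sum_range_succ' _ J, add_right_comm, ← Finset.sum_add_distrib]
  congr 1
  · refine Finset.sum_congr rfl fun j _ => ?_
    have e1 : k.1 + 1 - ((j + 1 : ℕ) : ℤ) = k.1 - j := by push_cast; ring
    have e2 : k.1 - ((j + 1 : ℕ) : ℤ) + 1 = k.1 - j := by push_cast; ring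
    have e3 : k.2 + ((j + 1 : ℕ) : ℤ) = k.2 + 1 + j := by push_cast; ring
    simp only [sh_apply, add_zero, e1, e2, e3, Ring.choose_succ_succ]
    push_cast
    ring
  · simp

theorem subst_mulSub {c : Arr} (hc : Trunc c) : subst (mulSub c) = sh 1 0 (subst c) := by
  have h1 : mulSub c = sh 1 0 c - sh 0 1 c := rfl
  rw [h1, subst_sub (hc.sh 1 0) (hc.sh 0 1), subst_sh_fst hc, subst_sh_snd]
  show (sh 1 0 + sh 0 1) (subst c) - _ = _
  rw [LinearMap.add_apply, add_sub_cancel_right]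

theorem subst_mulSub_pow {c : Arr} (hc : Trunc c) (n : ℕ) :
    Trunc ((mulSub ^ n) c) ∧ subst ((mulSub ^ n) c) = (sh 1 0 ^ n) (subst c) := by
  induction n with
  | zero => simpa using hc
  | succ n ih =>
    simp only [pow_succ', Module.End.mul_apply]
    exact ⟨ih.1.mulSub, by rw [subst_mulSub ih.1, ih.2]⟩

theorem subst_sh_fst_pow {c : Arr} (hc : Trunc c) (n : ℕ) :
    Trunc ((sh 1 0 ^ n) c) ∧ subst ((sh 1 0 ^ n) c) = (mulAdd ^ n) (subst c) := by
  induction n with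
  | zero => simpa using hc
  | succ n ih =>
    simp only [pow_succ', Module.End.mul_apply]
    exact ⟨ih.1.sh 1 0, by rw [subst_sh_fst ih.1, ih.2]⟩

/-- The coefficient array of the constant `a`. -/
def constArr (a : ℂ) : Arr := Pi.single (-1, -1) a

theorem constArr_van (a : ℂ) : Van (constArr a) := fun k hk => by
  rw [constArr, Pi.single_eq_of_ne]
  rintro rfl
  simp at hk

theorem ser_constArr (a z₁ z₂ : ℂ) : Ser (constArr a) z₁ z₂ a := by
  have := hasSum_single (f := fun k : ℤ × ℤ => constArr a k * z₁ ^ (-k.1 - 1) * z₂ ^ (-k.2 - 1))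
    (-1, -1) (fun k hk => by rw [constArr, Pi.single_eq_of_ne hk]; simp)
  unfold Ser
  simpa [constArr] using this

theorem trunc_constArr (a : ℂ) : Trunc (constArr a) := ⟨0, fun k hk => by
  rw [constArr, Pi.single_eq_of_ne]
  rintro rfl
  simp at hk⟩

theorem subst_constArr (a : ℂ) : subst (constArr a) = constArr a := by
  funext k
  unfold subst
  rw [finsum_eq_single _ 0]
  · simp
  · intro j hj
    by_cases h : (k.1 - (j : ℤ), k.2 + (j : ℤ)) = ((-1 : ℤ), (-1 : ℤ))
    · obtain ⟨m, rfl⟩ : ∃ m, j = m + 1 := ⟨j - 1, by omega⟩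
      have h1 : k.1 = (m : ℤ) := by
        have := congrArg Prod.fst h
        simp only at this
        push_cast at this
        omega
      rw [h1, Ring.choose_natCast, Nat.choose_succ_self]
      simp
    · rw [constArr, Pi.single_eq_of_ne h, mul_zero]

theorem exists_arr_of_mvPolynomial (M : MvPolynomial (Fin 2) ℂ) :
    ∃ l : Arr, Trunc l ∧ (∀ z₁ z₂ : ℂ, z₁ ≠ 0 → z₂ ≠ 0 →
      Ser l z₁ z₂ (MvPolynomial.eval ![z₁, z₂] M) ∧
      Ser (subst l) z₁ z₂ (MvPolynomial.eval ![z₁ + z₂, z₂] M)) := by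
  induction M using MvPolynomial.induction_on with
  | C a =>
    refine ⟨constArr a, trunc_constArr a, fun z₁ z₂ _ _ => ?_⟩
    rw [subst_constArr]
    simpa using ser_constArr a z₁ z₂
  | add p q hp hq =>
    obtain ⟨c, hc, hc'⟩ := hp
    obtain ⟨d, hd, hd'⟩ := hq
    refine ⟨c + d, hc.add hd, fun z₁ z₂ h₁ h₂ => ?_⟩
    rw [subst_add hc hd, map_add, map_add]
    exact ⟨(hc' z₁ z₂ h₁ h₂).1.add (hd' z₁ z₂ h₁ h₂).1,
      (hc' z₁ z₂ h₁ h₂).2.add (hd' z₁ z₂ h₁ h₂).2⟩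
  | mul_X p i hp =>
    obtain ⟨c, hc, hc'⟩ := hp
    fin_cases i
    · refine ⟨sh 1 0 c, hc.sh 1 0, fun z₁ z₂ h₁ h₂ => ?_⟩
      rw [subst_sh_fst hc]
      have e1 := (hc' z₁ z₂ h₁ h₂).1.sh 1 0 h₂ (Or.inl h₁)
      have e2 := (hc' z₁ z₂ h₁ h₂).2.mulAdd h₁ h₂
      simp only [zpow_one, zpow_zero, mul_one] at e1
      rw [mul_comm] at e1 e2
      simpa using And.intro e1 e2
    · refine ⟨sh 0 1 c, hc.sh 0 1, fun z₁ z₂ h₁ h₂ => ?_⟩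
      rw [subst_sh_snd]
      have e1 := (hc' z₁ z₂ h₁ h₂).1.sh 0 1 h₂ (Or.inl h₁)
      have e2 := (hc' z₁ z₂ h₁ h₂).2.sh 0 1 h₂ (Or.inl h₁)
      simp only [zpow_one, zpow_zero, one_mul] at e1 e2
      rw [mul_comm] at e1 e2
      simpa using And.intro e1 e2

theorem norm_pos_ne {z : ℂ} {r : ℝ} (hr : 0 < r) (h : ‖z‖ = r) : z ≠ 0 :=
  norm_pos_iff.1 (h ▸ hr)

/-- Formal weak associativity deduced from a common rational function. -/
theorem mulAdd_pow_subst_eq {P I : Arr} (hP : Trunc P) (M : MvPolynomial (Fin 2) ℂ) (C a b : ℕ)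
    (hPs : ∀ z₁ z₂ : ℂ, ‖z₂‖ < ‖z₁‖ → 0 < ‖z₂‖ →
      Ser P z₁ z₂ (MvPolynomial.eval ![z₁, z₂] M / (z₁ ^ C * z₂ ^ a * (z₁ - z₂) ^ b)))
    (hI : ∀ z₀ z₂ : ℂ, ‖z₀‖ < ‖z₂‖ → 0 < ‖z₀‖ →
      Ser I z₀ z₂ (MvPolynomial.eval ![z₀ + z₂, z₂] M / ((z₀ + z₂) ^ C * z₂ ^ a * z₀ ^ b))) :
    (mulAdd ^ C) (subst P) = (mulAdd ^ C) I := by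
  obtain ⟨l, hl, hl'⟩ := exists_arr_of_mvPolynomial M
  have hX : (mulSub ^ b) (sh 0 a ((sh 1 0 ^ C) P)) = l := by
    refine Ser.ext (ρ₁ := 2) (ρ₂ := 1) (by norm_num) (by norm_num) fun z₁ z₂ h₁ h₂ => ?_
    have n₁ := norm_pos_ne (by norm_num) h₁
    have n₂ := norm_pos_ne (by norm_num) h₂
    have n₃ : z₁ - z₂ ≠ 0 := sub_ne_zero.2 fun e => by rw [e, h₂] at h₁; norm_num at h₁
    refine ⟨_, ?_, (hl' z₁ z₂ n₁ n₂).1⟩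
    have e := (((hPs z₁ z₂ (by rw [h₁, h₂]; norm_num) (by rw [h₂]; norm_num)).sh (C * 1) (C * 0) n₂
      (Or.inl n₁)).sh 0 a n₂ (Or.inl n₁)).mulSub_pow n₁ n₂ b
    rw [sh_pow]
    convert e using 1
    simp only [mul_one, mul_zero, zpow_zero, zpow_natCast, one_mul]
    field_simp
  have hY : sh (b * 1) (b * 0) (sh 0 a ((mulAdd ^ C) I)) = subst l := by
    refine Ser.ext (ρ₁ := 1) (ρ₂ := 2) (by norm_num) (by norm_num) fun z₁ z₂ h₁ h₂ => ?_
    have n₁ := norm_pos_ne (by norm_num) h₁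
    have n₂ := norm_pos_ne (by norm_num) h₂
    have n₃ : z₁ + z₂ ≠ 0 := fun e => by
      rw [eq_neg_of_add_eq_zero_left e, norm_neg, h₂] at h₁; norm_num at h₁
    refine ⟨_, ?_, (hl' z₁ z₂ n₁ n₂).2⟩
    have e := (((hI z₁ z₂ (by rw [h₁, h₂]; norm_num) (by rw [h₁]; norm_num)).mulAdd_pow n₁ n₂ C).sh
      0 a n₂ (Or.inl n₁)).sh (b * 1) (b * 0) n₂ (Or.inl n₁)
    convert e using 1
    simp only [mul_one, mul_zero, zpow_zero, zpow_natCast, one_mul]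
    field_simp
  have h1 := subst_sh_fst_pow hP C
  rw [← hX, (subst_mulSub_pow (h1.1.sh 0 a) b).2, subst_sh_snd, h1.2, sh_pow] at hY
  exact (sh_injective 0 a (sh_injective _ _ hY)).symm

theorem RatFn.eval_fin_two (R : RatFn (Fin 2)) {C : ℕ} (hC : R.a 0 ≤ C) :
    ∃ (M : MvPolynomial (Fin 2) ℂ) (a b : ℕ), ∀ z₁ z₂ : ℂ, z₁ ≠ 0 →
      R.eval ![z₁, z₂] = MvPolynomial.eval ![z₁, z₂] M / (z₁ ^ C * z₂ ^ a * (z₁ - z₂) ^ b) := by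
  refine ⟨R.num * MvPolynomial.X 0 ^ (C - R.a 0) * MvPolynomial.C ((-1) ^ R.b 1 0),
    R.a 1, R.b 0 1 + R.b 1 0, fun z₁ z₂ h₁ => ?_⟩
  have hd : (Finset.univ : Finset (Fin 2)).offDiag = {(0, 1), (1, 0)} := by decide
  have e1 : z₁ ^ C = z₁ ^ R.a 0 * z₁ ^ (C - R.a 0) := by rw [← pow_add]; congr 1; omega
  have e2 : (z₂ - z₁) ^ R.b 1 0 = (-1) ^ R.b 1 0 * (z₁ - z₂) ^ R.b 1 0 := by
    rw [← mul_pow]; congr 1; ring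
  have e3 : ((-1 : ℂ) ^ R.b 1 0) * (-1) ^ R.b 1 0 = 1 := by rw [← mul_pow]; simp
  have h2 : z₁ ^ (C - R.a 0) ≠ 0 := pow_ne_zero _ h₁
  have h3 : ((-1 : ℂ) ^ R.b 1 0) ≠ 0 := pow_ne_zero _ (by norm_num)
  unfold RatFn.eval
  rw [hd, Finset.prod_pair (by decide), Fin.prod_univ_two]
  simp only [Matrix.cons_val_zero, Matrix.cons_val_one, map_mul, map_pow, MvPolynomial.eval_X,
    MvPolynomial.eval_C]
  rw [e1, e2]
  have h5 := mul_div_mul_right (MvPolynomial.eval ![z₁, z₂] R.num)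
    (z₁ ^ R.a 0 * z₂ ^ R.a 1 * ((z₁ - z₂) ^ R.b 0 1 * ((-1) ^ R.b 1 0 * (z₁ - z₂) ^ R.b 1 0)))
    (mul_ne_zero h2 h3)
  rw [← h5]
  congr 1
  · ring
  · rw [pow_add]
    linear_combination (z₁ ^ R.a 0 * z₁ ^ (C - R.a 0) * z₂ ^ R.a 1 *
      ((z₁ - z₂) ^ R.b 0 1 * (z₁ - z₂) ^ R.b 1 0)) * e3

theorem eval_div_eq_of_region {M M' : MvPolynomial (Fin 2) ℂ} {p a b p' a' b' : ℕ}
    (h : ∀ z₁ z₂ : ℂ, ‖z₂‖ < ‖z₁‖ → 0 < ‖z₂‖ →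
      MvPolynomial.eval ![z₁, z₂] M / (z₁ ^ p * z₂ ^ a * (z₁ - z₂) ^ b) =
      MvPolynomial.eval ![z₁, z₂] M' / (z₁ ^ p' * z₂ ^ a' * (z₁ - z₂) ^ b'))
    {z₁ z₂ : ℂ} (h₁ : z₁ ≠ 0) (h₂ : z₂ ≠ 0) (h₁₂ : z₁ - z₂ ≠ 0) :
    MvPolynomial.eval ![z₁, z₂] M / (z₁ ^ p * z₂ ^ a * (z₁ - z₂) ^ b) =
      MvPolynomial.eval ![z₁, z₂] M' / (z₁ ^ p' * z₂ ^ a' * (z₁ - z₂) ^ b') := by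
  have hden : ∀ {z₁ z₂ : ℂ} (p a b : ℕ), z₁ ≠ 0 → z₂ ≠ 0 → z₁ - z₂ ≠ 0 →
      z₁ ^ p * z₂ ^ a * (z₁ - z₂) ^ b ≠ 0 := fun p a b h1 h2 h3 =>
    mul_ne_zero (mul_ne_zero (pow_ne_zero _ h1) (pow_ne_zero _ h2)) (pow_ne_zero _ h3)
  let X : Fin 2 → MvPolynomial (Fin 2) ℂ := MvPolynomial.X
  have hpoly : M * (X 0 ^ p' * X 1 ^ a' * (X 0 - X 1) ^ b') =
      M' * (X 0 ^ p * X 1 ^ a * (X 0 - X 1) ^ b) := by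
    refine MvPolynomial.funext_set
      ![{z : ℂ | 2 < ‖z‖}, {z : ℂ | 1 < ‖z‖ ∧ ‖z‖ < 2}] ?_ fun x hx => ?_
    · intro i
      fin_cases i
      · exact infinite_of_mem_nhds (3 : ℂ)
          ((isOpen_lt continuous_const continuous_norm).mem_nhds (by simp; norm_num))
      · exact infinite_of_mem_nhds (3 / 2 : ℂ)
          (((isOpen_lt continuous_const continuous_norm).inter
            (isOpen_lt continuous_norm continuous_const)).mem_nhds (by simp; norm_num))
    · have hx0 : 2 < ‖x 0‖ := hx 0 trivial
      have hx1 : 1 < ‖x 1‖ ∧ ‖x 1‖ < 2 := hx 1 trivial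
      have n0 : x 0 ≠ 0 := norm_pos_iff.1 (by linarith)
      have n1 : x 1 ≠ 0 := norm_pos_iff.1 (by linarith)
      have n2 : x 0 - x 1 ≠ 0 := sub_ne_zero.2 fun e => by rw [e] at hx0; linarith
      have hxe : x = ![x 0, x 1] := by
        funext i; fin_cases i <;> rfl
      have := h (x 0) (x 1) (by linarith) (by linarith)
      rw [← hxe, div_eq_div_iff (hden p a b n0 n1 n2) (hden p' a' b' n0 n1 n2)] at this
      simpa [X] using this
  rw [div_eq_div_iff (hden p a b h₁ h₂ h₁₂) (hden p' a' b' h₁ h₂ h₁₂)]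
  simpa [X] using congrArg (MvPolynomial.eval ![z₁, z₂]) hpoly

section WeakCommutativity

variable {V : Type*} [AddCommGroup V] [Module ℂ V]
variable {W : Type*} [AddCommGroup W] [Module ℂ W] {A : MOSVA V}

theorem CGrading.eq_of_comp_proj_eq (G : CGrading W) {φ : W →ₗ[ℂ] ℂ}
    (h : ∀ n, φ ∘ₗ G.proj n = 0) : φ = 0 := by
  ext w
  have h1 := AddMonoidHom.map_finsum φ.toAddMonoidHom (G.proj_finite w)
  rw [G.proj_sum] at h1
  simp only [LinearMap.toAddMonoidHom_coe] at h1
  rw [h1, LinearMap.zero_apply]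
  exact finsum_eq_zero_of_forall_eq_zero fun n => congrArg (fun T : W →ₗ[ℂ] ℂ => T w) (h n)

theorem Bimod.DW_pow_comp_proj (B : Bimod A W) (m : ℕ) (n : ℂ) :
    (B.DW ^ m) ∘ₗ B.gr.proj n = B.gr.proj (n + m) ∘ₗ (B.DW ^ m) ∘ₗ B.gr.proj n := by
  induction m with
  | zero =>
    ext w
    have := congrArg (fun T : W →ₗ[ℂ] W => T w) (B.gr.proj_comp n n)
    simpa using this.symm
  | succ m ih =>
    ext w
    have h1 := congrArg (fun T : W →ₗ[ℂ] W => T w) ih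
    have h2 := congrArg (fun T : W →ₗ[ℂ] W => T ((B.DW ^ m) (B.gr.proj n w))) (B.DW_wt (n + m))
    simp only [LinearMap.comp_apply] at h1 h2 ⊢
    rw [← h1] at h2
    rw [pow_succ', Module.End.mul_apply]
    push_cast
    rw [← add_assoc, ← h2]

theorem Bimod.comp_DW_pow_comp_proj (B : Bimod A W) {φ : W →ₗ[ℂ] ℂ} {m : ℕ} {n : ℂ}
    (h : φ ∘ₗ B.gr.proj (n + m) = 0) : (φ ∘ₗ (B.DW ^ m)) ∘ₗ B.gr.proj n = 0 := by
  rw [LinearMap.comp_assoc, B.DW_pow_comp_proj, ← LinearMap.comp_assoc, h, LinearMap.zero_comp]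

theorem Bimod.inGradedDual_comp_DW_pow (B : Bimod A W) {φ : W →ₗ[ℂ] ℂ}
    (hφ : InGradedDual B.gr.proj φ) (m : ℕ) : InGradedDual B.gr.proj (φ ∘ₗ (B.DW ^ m)) := by
  refine Set.Finite.subset (Set.Finite.preimage (f := fun n : ℂ => n + m)
    (add_left_injective _).injOn hφ) fun n hn => ?_
  exact fun h => hn (B.comp_DW_pow_comp_proj h)

theorem Bimod.exists_comp_DW_pow_eq_zero (B : Bimod A W) {φ : W →ₗ[ℂ] ℂ}
    (hφ : InGradedDual B.gr.proj φ) : ∃ M : ℕ, ∀ m, M ≤ m → φ ∘ₗ (B.DW ^ m) = 0 := by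
  obtain ⟨b, hb⟩ := B.gr.lower_bound
  obtain ⟨r, hr⟩ := (Set.Finite.image Complex.re hφ).bddAbove
  obtain ⟨M, hM⟩ := exists_nat_gt (r - b)
  refine ⟨M, fun m hm => B.gr.eq_of_comp_proj_eq fun n => ?_⟩
  by_cases hn : n.re < b
  · rw [hb n hn, LinearMap.comp_zero]
  · refine B.comp_DW_pow_comp_proj ?_
    by_contra h
    have h1 := hr ⟨n + m, h, rfl⟩
    have h2 : (M : ℝ) ≤ m := by exact_mod_cast hm
    simp at h1
    linarith

theorem Bimod.YL_DW_pow (B : Bimod A W) (u : V) (w : W) (m : ℕ) (k : ℤ) :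
    ((m.factorial : ℂ))⁻¹ • B.YL u ((B.DW ^ m) w) k =
      ∑ p ∈ Finset.HasAntidiagonal.antidiagonal m, (((Ring.choose k p.2 : ℤ) : ℂ) * ((p.1.factorial : ℂ))⁻¹) •
        (B.DW ^ p.1) (B.YL u w (k - p.2)) := by
  induction m generalizing k with
  | zero => simp
  | succ m ih =>
    have hm : ((m : ℂ) + 1) ≠ 0 := by exact_mod_cast Nat.succ_ne_zero m
    have hcomm : B.YL u (B.DW ((B.DW ^ m) w)) k =
        B.DW (B.YL u ((B.DW ^ m) w) k) + (k : ℂ) • B.YL u ((B.DW ^ m) w) (k - 1) := by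
      have h := B.D_commL u ((B.DW ^ m) w) k
      rw [neg_smul, sub_eq_iff_eq_add] at h
      rw [h]; abel
    have hfac : ((m : ℂ) + 1) • ((((m + 1).factorial : ℕ) : ℂ)⁻¹ • B.YL u ((B.DW ^ (m + 1)) w) k) =
        B.DW (((m.factorial : ℂ))⁻¹ • B.YL u ((B.DW ^ m) w) k) +
        (k : ℂ) • (((m.factorial : ℂ))⁻¹ • B.YL u ((B.DW ^ m) w) (k - 1)) := by
      rw [pow_succ', Module.End.mul_apply, hcomm, smul_smul, Nat.factorial_succ]
      push_cast
      rw [mul_inv, mul_inv_cancel_left₀ hm, smul_add, map_smul, smul_comm]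
    rw [ih, ih] at hfac
    refine smul_right_injective W hm ?_
    simp only
    rw [hfac]
    have e1 : ((m : ℂ) + 1) • ∑ p ∈ Finset.HasAntidiagonal.antidiagonal (m + 1),
        (((Ring.choose k p.2 : ℤ) : ℂ) * ((p.1.factorial : ℂ))⁻¹) •
        (B.DW ^ p.1) (B.YL u w (k - p.2)) =
        (∑ p ∈ Finset.HasAntidiagonal.antidiagonal (m + 1), ((p.1 : ℂ) *
          (((Ring.choose k p.2 : ℤ) : ℂ) * ((p.1.factorial : ℂ))⁻¹)) •
          (B.DW ^ p.1) (B.YL u w (k - p.2))) +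
        ∑ p ∈ Finset.HasAntidiagonal.antidiagonal (m + 1), ((p.2 : ℂ) *
          (((Ring.choose k p.2 : ℤ) : ℂ) * ((p.1.factorial : ℂ))⁻¹)) •
          (B.DW ^ p.1) (B.YL u w (k - p.2)) := by
      rw [Finset.smul_sum, ← Finset.sum_add_distrib]
      refine Finset.sum_congr rfl fun p hp => ?_
      rw [← add_smul, smul_smul, ← add_mul]
      congr 2
      have := Finset.HasAntidiagonal.mem_antidiagonal.1 hp
      exact_mod_cast this.symm
    rw [e1, Finset.Nat.sum_antidiagonal_succ, Finset.Nat.sum_antidiagonal_succ', map_sum,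
      Finset.smul_sum]
    simp only [Nat.cast_zero, zero_mul, zero_smul, zero_add]
    congr 1
    · refine Finset.sum_congr rfl fun p _ => ?_
      have hp : ((p.1 : ℂ) + 1) ≠ 0 := by exact_mod_cast Nat.succ_ne_zero p.1
      rw [map_smul, pow_succ', Module.End.mul_apply, Nat.factorial_succ]
      congr 1
      push_cast
      field_simp
    · refine Finset.sum_congr rfl fun p _ => ?_
      rw [smul_smul]
      have h1 : k * Ring.choose (k - 1) p.2 = (p.2 + 1) * Ring.choose k (p.2 + 1) := by
        have := Ring.choose_smul_choose k (n := p.2 + 1) (k := 1) (by omega)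
        simpa [Ring.choose_one_right] using this.symm
      have h2 : (k : ℂ) * ((Ring.choose (k - 1) p.2 : ℤ) : ℂ) =
          ((p.2 : ℂ) + 1) * ((Ring.choose k (p.2 + 1) : ℤ) : ℂ) := by exact_mod_cast h1
      have h3 : k - 1 - (p.2 : ℤ) = k - ((p.2 + 1 : ℕ) : ℤ) := by push_cast; ring
      rw [h3, ← mul_assoc, ← mul_assoc, h2]
      push_cast
      rfl

/-- Formal weak associativity for the left and right vertex operator maps. -/
theorem Bimod.mulAdd_pow_subst_eq (B : Bimod A W) {u₁ u₂ : V} {w : W} {C : ℕ} {φ : W →ₗ[ℂ] ℂ}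
    (hφ : InGradedDual B.gr.proj φ)
    (hC : ∃ R : RatFn (Fin 2), R.a 0 ≤ C ∧
      ∀ z₁ z₂ : ℂ, ‖z₂‖ < ‖z₁‖ → 0 < ‖z₂‖ →
        AbsConvTo (fun k : ℤ × ℤ =>
            φ (B.YL u₁ (B.YR w u₂ k.2) k.1) * z₁ ^ (-k.1 - 1) * z₂ ^ (-k.2 - 1))
          (R.eval ![z₁, z₂])) :
    (mulAdd ^ C) (subst fun k => φ (B.YL u₁ (B.YR w u₂ k.2) k.1)) =
      (mulAdd ^ C) fun k => φ (B.YR (B.YL u₁ w k.1) u₂ k.2) := by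
  obtain ⟨R, hRC, hR⟩ := hC
  obtain ⟨R', h1, h2⟩ := B.compatAssoc u₁ u₂ w φ hφ
  obtain ⟨M, a, b, hM⟩ := R.eval_fin_two hRC
  obtain ⟨M', a', b', hM'⟩ := R'.eval_fin_two le_rfl
  have hreg : ∀ z₁ z₂ : ℂ, ‖z₂‖ < ‖z₁‖ → 0 < ‖z₂‖ →
      MvPolynomial.eval ![z₁, z₂] M' / (z₁ ^ R'.a 0 * z₂ ^ a' * (z₁ - z₂) ^ b') =
      MvPolynomial.eval ![z₁, z₂] M / (z₁ ^ C * z₂ ^ a * (z₁ - z₂) ^ b) := fun z₁ z₂ h h' => by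
    have n₁ : z₁ ≠ 0 := norm_pos_iff.1 (h'.trans h)
    rw [← hM z₁ z₂ n₁, ← hM' z₁ z₂ n₁]
    exact (absConvTo_iff.1 (h1 z₁ z₂ h h')).unique (absConvTo_iff.1 (hR z₁ z₂ h h'))
  refine VA.mulAdd_pow_subst_eq ?_ M C a b (fun z₁ z₂ h h' => ?_) (fun z₀ z₂ h h' => ?_)
  · obtain ⟨N, hN⟩ := B.truncR w u₂
    exact ⟨N, fun k hk => by simp [hN k.2 hk]⟩
  · rw [← hM z₁ z₂ (norm_pos_iff.1 (h'.trans h))]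
    exact absConvTo_iff.1 (hR z₁ z₂ h h')
  · have n₀ : z₀ ≠ 0 := norm_pos_iff.1 h'
    have n₂ : z₂ ≠ 0 := norm_pos_iff.1 (h'.trans h)
    have n₁ : z₀ + z₂ ≠ 0 := fun e => by
      rw [eq_neg_of_add_eq_zero_left e, norm_neg] at h; exact lt_irrefl _ h
    have e := absConvTo_iff.1 (h2 (z₀ + z₂) z₂ (by simpa using h) (by simpa using h'))
    rw [hM' _ _ n₁, eval_div_eq_of_region hreg n₁ n₂ (by simpa using n₀)] at e
    unfold Ser
    simpa only [add_sub_cancel_right] using e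

/-- The effect on coefficient arrays of substituting `-z₂` for `z₂` and multiplying by a power
of `z₂`. -/
def twist (i : ℕ) : Module.End ℂ Arr where
  toFun c k := (-1 : ℂ) ^ (k.2 + i + 1) * c (k.1, k.2 + i)
  map_add' c d := by funext k; simp [mul_add]
  map_smul' a c := by funext k; simp [mul_left_comm]

theorem twist_apply (i : ℕ) (c : Arr) (k : ℤ × ℤ) :
    twist i c k = (-1 : ℂ) ^ (k.2 + i + 1) * c (k.1, k.2 + i) := rfl

theorem mulSub_twist (i : ℕ) (c : Arr) : mulSub (twist i c) = twist i (mulAdd c) := by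
  funext k
  rw [mulSub_apply, twist_apply, twist_apply, twist_apply, mulAdd_apply]
  have h : (-1 : ℂ) ^ (k.2 + 1 + i + 1) = - (-1 : ℂ) ^ (k.2 + i + 1) := by
    rw [show k.2 + 1 + (i : ℤ) + 1 = (k.2 + i + 1) + 1 by ring, zpow_add_one₀ (by norm_num)]
    ring
  simp only [h]
  rw [show k.2 + 1 + (i : ℤ) = k.2 + i + 1 by ring]
  ring

theorem mulSub_pow_twist (i n : ℕ) (c : Arr) :
    (mulSub ^ n) (twist i c) = twist i ((mulAdd ^ n) c) := by
  induction n generalizing c with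
  | zero => simp
  | succ n ih => rw [pow_succ, pow_succ, Module.End.mul_apply, mulSub_twist, ih,
      Module.End.mul_apply]

theorem Bimod.YsR_eq_sum (B : Bimod A W) {u : V} {w : W} {N : ℤ}
    (hN : ∀ k, N ≤ k → B.YR w u k = 0) {k : ℤ} {J : ℕ} (hJ : N ≤ k + J) :
    B.YsR u w k = ∑ m ∈ Finset.range J, ((-1 : ℂ) ^ (k + (m : ℤ) + 1) * ((m.factorial : ℂ))⁻¹) •
      (B.DW ^ m) (B.YR w u (k + m)) := by
  unfold Bimod.YsR
  refine finsum_eq_sum_of_support_subset _ fun m hm => ?_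
  by_contra h
  refine hm ?_
  have h1 : J ≤ m := by simpa using h
  have h2 : (J : ℤ) ≤ m := by exact_mod_cast h1
  simp only [hN (k + m) (by omega), map_zero, smul_zero]

theorem Bimod.YsR_add (B : Bimod A W) (u : V) (x y : W) (k : ℤ) :
    B.YsR u (x + y) k = B.YsR u x k + B.YsR u y k := by
  obtain ⟨N, hN⟩ := B.truncR x u
  obtain ⟨N', hN'⟩ := B.truncR y u
  have h1 : N ≤ k + ((max N N' - k).toNat : ℤ) := by omega
  have h2 : N' ≤ k + ((max N N' - k).toNat : ℤ) := by omega
  have h3 : max N N' ≤ k + ((max N N' - k).toNat : ℤ) := by omega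
  rw [B.YsR_eq_sum hN h1, B.YsR_eq_sum hN' h2, B.YsR_eq_sum (N := max N N') (fun l hl => by
      simp [hN l (by omega), hN' l (by omega)]) h3, ← Finset.sum_add_distrib]
  refine Finset.sum_congr rfl fun m _ => ?_
  simp

theorem Bimod.YsR_smul (B : Bimod A W) (u : V) (a : ℂ) (x : W) (k : ℤ) :
    B.YsR u (a • x) k = a • B.YsR u x k := by
  obtain ⟨N, hN⟩ := B.truncR x u
  have h1 : N ≤ k + ((N - k).toNat : ℤ) := by omega
  rw [B.YsR_eq_sum hN h1, B.YsR_eq_sum (N := N) (fun l hl => by simp [hN l hl]) h1,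
    Finset.smul_sum]
  refine Finset.sum_congr rfl fun m _ => ?_
  simp only [map_smul, LinearMap.smul_apply, Pi.smul_apply]
  rw [smul_comm]

theorem Bimod.YL_YsR_eq (B : Bimod A W) (u₁ u₂ : V) (w : W) {φ : W →ₗ[ℂ] ℂ} {M : ℕ}
    (hM : ∀ m, M ≤ m → φ ∘ₗ (B.DW ^ m) = 0) :
    (fun k : ℤ × ℤ => φ (B.YL u₁ (B.YsR u₂ w k.2) k.1)) =
      ∑ i ∈ Finset.range M, ((i.factorial : ℂ))⁻¹ • twist i
        (subst fun k => (φ ∘ₗ (B.DW ^ i)) (B.YL u₁ (B.YR w u₂ k.2) k.1)) := by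
  obtain ⟨N, hN⟩ := B.truncR w u₂
  funext k
  obtain ⟨J, hJM, hJ⟩ : ∃ J : ℕ, M ≤ J ∧ N ≤ k.2 + J :=
    ⟨M + (N - k.2).toNat, by omega, by omega⟩
  rw [B.YsR_eq_sum hN hJ, Finset.sum_apply]
  have hsub : ∀ i ∈ Finset.range J, (((i.factorial : ℂ))⁻¹ • twist i
      (subst fun k => (φ ∘ₗ (B.DW ^ i)) (B.YL u₁ (B.YR w u₂ k.2) k.1))) k =
      ∑ j ∈ Finset.range (J - i), (-1 : ℂ) ^ (k.2 + ((i + j : ℕ) : ℤ) + 1) *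
        (((Ring.choose k.1 j : ℤ) : ℂ) * ((i.factorial : ℂ))⁻¹ *
          (φ ∘ₗ (B.DW ^ i)) (B.YL u₁ (B.YR w u₂ (k.2 + ((i + j : ℕ) : ℤ))) (k.1 - j))) := by
    intro i hi
    have hi' := Finset.mem_range.1 hi
    rw [Pi.smul_apply, twist_apply, subst_eq (N := N) (fun l hl => by simp [hN l.2 hl])
      (J := J - i) _ (by simp only; omega), Finset.mul_sum, Finset.smul_sum]
    refine Finset.sum_congr rfl fun j _ => ?_
    rw [show k.2 + ((i + j : ℕ) : ℤ) + 1 = (k.2 + i + 1) + j by push_cast; ring,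
      zpow_add₀ (by norm_num) _ (j : ℤ), zpow_natCast,
      show k.2 + ((i + j : ℕ) : ℤ) = k.2 + i + j by push_cast; ring]
    simp only [smul_eq_mul]
    push_cast
    ring
  have hdrop : ∑ i ∈ Finset.range M, (((i.factorial : ℂ))⁻¹ • twist i
      (subst fun k => (φ ∘ₗ (B.DW ^ i)) (B.YL u₁ (B.YR w u₂ k.2) k.1))) k =
      ∑ i ∈ Finset.range J, (((i.factorial : ℂ))⁻¹ • twist i
      (subst fun k => (φ ∘ₗ (B.DW ^ i)) (B.YL u₁ (B.YR w u₂ k.2) k.1))) k := by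
    refine Finset.sum_subset (Finset.range_subset_range.2 hJM) fun i _ hi => ?_
    rw [hM i (by simpa using hi)]
    simp [twist_apply, subst]
  rw [hdrop, Finset.sum_congr rfl hsub, ← Finset.sum_range_diag_flip J fun i j =>
      (-1 : ℂ) ^ (k.2 + ((i + j : ℕ) : ℤ) + 1) *
        (((Ring.choose k.1 j : ℤ) : ℂ) * ((i.factorial : ℂ))⁻¹ *
          (φ ∘ₗ (B.DW ^ i)) (B.YL u₁ (B.YR w u₂ (k.2 + ((i + j : ℕ) : ℤ))) (k.1 - j))),
    map_sum, Finset.sum_apply, map_sum]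
  refine Finset.sum_congr rfl fun m _ => ?_
  rw [map_smul, Pi.smul_apply, mul_smul, B.YL_DW_pow, map_smul, map_sum,
    Finset.Nat.sum_antidiagonal_eq_sum_range_succ (fun i j => φ ((((Ring.choose k.1 j : ℤ) : ℂ) *
      ((i.factorial : ℂ))⁻¹) • (B.DW ^ i) (B.YL u₁ (B.YR w u₂ (k.2 + (m : ℤ))) (k.1 - j)))),
    Finset.smul_sum]
  refine Finset.sum_congr rfl fun i hi => ?_
  rw [Nat.add_sub_cancel' (Finset.mem_range_succ_iff.1 hi), map_smul]
  simp only [smul_eq_mul, LinearMap.comp_apply]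

theorem Bimod.YsR_YL_eq (B : Bimod A W) (u₁ u₂ : V) (w : W) {φ : W →ₗ[ℂ] ℂ} {M : ℕ}
    (hM : ∀ m, M ≤ m → φ ∘ₗ (B.DW ^ m) = 0) :
    (fun k : ℤ × ℤ => φ (B.YsR u₂ (B.YL u₁ w k.1) k.2)) =
      ∑ i ∈ Finset.range M, ((i.factorial : ℂ))⁻¹ • twist i
        (fun k => (φ ∘ₗ (B.DW ^ i)) (B.YR (B.YL u₁ w k.1) u₂ k.2)) := by
  funext k
  obtain ⟨N, hN⟩ := B.truncR (B.YL u₁ w k.1) u₂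
  obtain ⟨J, hJM, hJ⟩ : ∃ J : ℕ, M ≤ J ∧ N ≤ k.2 + J :=
    ⟨M + (N - k.2).toNat, by omega, by omega⟩
  rw [B.YsR_eq_sum hN hJ, Finset.sum_apply, map_sum]
  symm
  rw [Finset.sum_subset (Finset.range_subset_range.2 hJM) fun i _ hi => by
    simp [twist_apply, hM i (by simpa using hi)]]
  refine Finset.sum_congr rfl fun i _ => ?_
  simp only [Pi.smul_apply, twist_apply, LinearMap.comp_apply, map_smul, smul_eq_mul]
  ring

/-- Weak commutativity of left and opposite right vertex operators. -/
theorem Bimod.weakComm (B : Bimod A W) {u₁ u₂ : V} {C : ℕ}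
    (hC : ∀ φ : W →ₗ[ℂ] ℂ, InGradedDual B.gr.proj φ → ∀ w : W,
      ∃ R : RatFn (Fin 2), R.a 0 ≤ C ∧
      ∀ z₁ z₂ : ℂ, ‖z₂‖ < ‖z₁‖ → 0 < ‖z₂‖ →
        AbsConvTo (fun k : ℤ × ℤ =>
            φ (B.YL u₁ (B.YR w u₂ k.2) k.1) * z₁ ^ (-k.1 - 1) * z₂ ^ (-k.2 - 1))
          (R.eval ![z₁, z₂])) {φ : W →ₗ[ℂ] ℂ} (hφ : InGradedDual B.gr.proj φ) (w : W) :
    (mulSub ^ C) (fun k => φ (B.YL u₁ (B.YsR u₂ w k.2) k.1)) =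
      (mulSub ^ C) fun k => φ (B.YsR u₂ (B.YL u₁ w k.1) k.2) := by
  obtain ⟨M, hM⟩ := B.exists_comp_DW_pow_eq_zero hφ
  rw [B.YL_YsR_eq u₁ u₂ w hM, B.YsR_YL_eq u₁ u₂ w hM, map_sum, map_sum]
  refine Finset.sum_congr rfl fun i _ => ?_
  have h := B.inGradedDual_comp_DW_pow hφ i
  rw [map_smul, map_smul, mulSub_pow_twist, mulSub_pow_twist,
    B.mulAdd_pow_subst_eq h (hC _ h w)]

end WeakCommutativity

section Completion

variable {V : Type*} [AddCommGroup V] [Module ℂ V]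
variable {W : Type*} [AddCommGroup W] [Module ℂ W] {A : MOSVA V}

theorem CGrading.proj_proj (G : CGrading W) (m n : ℂ) (w : W) :
    G.proj m (G.proj n w) = if m = n then G.proj n w else 0 := by
  have := congrArg (fun T : W →ₗ[ℂ] W => T w) (G.proj_comp m n)
  split_ifs at this ⊢ <;> simpa using this

theorem ZGrading.proj_proj (G : ZGrading V) (m n : ℤ) (v : V) :
    G.proj m (G.proj n v) = if m = n then G.proj n v else 0 := by
  have := congrArg (fun T : V →ₗ[ℂ] V => T v) (G.proj_comp m n)
  split_ifs at this ⊢ <;> simpa using this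

theorem CGrading.proj_eq_zero (G : CGrading W) {m n : ℂ} {w : W} (hw : G.proj n w = w)
    (h : m ≠ n) : G.proj m w = 0 := by
  rw [← hw, G.proj_proj, if_neg h]

theorem CGrading.d_eq_smul (G : CGrading W) {n : ℂ} {w : W} (hw : G.proj n w = w) :
    G.d w = n • w := by
  unfold CGrading.d
  rw [finsum_eq_single _ n fun m hm => by rw [G.proj_eq_zero hw hm, smul_zero], hw]

theorem ZGrading.d_proj (G : ZGrading V) (n : ℤ) (v : V) :
    G.d (G.proj n v) = (n : ℂ) • G.proj n v := by
  unfold ZGrading.d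
  rw [finsum_eq_single _ n fun m hm => by rw [G.proj_proj, if_neg hm, smul_zero], G.proj_proj,
    if_pos rfl]

theorem CGrading.proj_eq_self_of_d (G : CGrading W) {n : ℂ} {w : W} (hw : G.d w = n • w) :
    G.proj n w = w := by
  have hfin := G.proj_finite w
  have h0 : ∀ m, m ≠ n → G.proj m w = 0 := fun m hm => by
    have hfin' : (Function.support fun l => l • G.proj l w).Finite :=
      hfin.subset fun l hl => fun h => hl (by simp only at h ⊢; rw [h, smul_zero])
    have h1 := AddMonoidHom.map_finsum (G.proj m).toAddMonoidHom hfin'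
    simp only [LinearMap.toAddMonoidHom_coe, map_smul] at h1
    have h2 : (∑ᶠ l : ℂ, l • G.proj l w) = n • w := hw
    rw [h2, map_smul, finsum_eq_single _ m fun l hl => by
      rw [G.proj_proj, if_neg hl.symm, smul_zero], G.proj_proj, if_pos rfl, ← sub_eq_zero,
      ← sub_smul] at h1
    exact (smul_eq_zero.1 h1).resolve_left (sub_ne_zero.2 hm.symm)
  have h := G.proj_sum w
  rwa [finsum_eq_single _ n h0] at h

theorem Bimod.DW_pow_proj_eq_self (B : Bimod A W) {n : ℂ} {w : W} (hw : B.gr.proj n w = w)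
    (m : ℕ) : B.gr.proj (n + m) ((B.DW ^ m) w) = (B.DW ^ m) w := by
  have := congrArg (fun T : W →ₗ[ℂ] W => T w) (B.DW_pow_comp_proj m n)
  simpa only [LinearMap.comp_apply, hw] using this.symm

theorem Bimod.YL_proj_eq_self (B : Bimod A W) (u : V) (p : ℤ) {n : ℂ} {w : W}
    (hw : B.gr.proj n w = w) (k : ℤ) :
    B.gr.proj (n + p - k - 1) (B.YL (A.gr.proj p u) w k) = B.YL (A.gr.proj p u) w k := by
  refine B.gr.proj_eq_self_of_d ?_
  rw [B.d_commL, A.gr.d_proj, B.gr.d_eq_smul hw]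
  simp only [map_smul, LinearMap.smul_apply, Pi.smul_apply]
  module

theorem Bimod.YR_proj_eq_self (B : Bimod A W) (u : V) (p : ℤ) {n : ℂ} {w : W}
    (hw : B.gr.proj n w = w) (k : ℤ) :
    B.gr.proj (n + p - k - 1) (B.YR w (A.gr.proj p u) k) = B.YR w (A.gr.proj p u) k := by
  refine B.gr.proj_eq_self_of_d ?_
  rw [B.d_commR, A.gr.d_proj, B.gr.d_eq_smul hw]
  simp only [map_smul, LinearMap.smul_apply, Pi.smul_apply]
  module

/-- `L` raises weights by an element of `{p - k - 1 | p ∈ S}`. -/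
def CGrading.Shifts (G : CGrading W) (S : Finset ℤ) (k : ℤ) (L : W → W) : Prop :=
  ∀ (n : ℂ) (w : W), G.proj n w = w → ∀ m : ℂ, (∀ p ∈ S, m ≠ n + p - k - 1) → G.proj m (L w) = 0

theorem ZGrading.sum_proj (G : ZGrading V) (v : V) :
    ∑ p ∈ (G.proj_finite v).toFinset, G.proj p v = v := by
  rw [← finsum_eq_sum _ (G.proj_finite v), G.proj_sum]

theorem Bimod.shifts_YL (B : Bimod A W) (u : V) (k : ℤ) :
    B.gr.Shifts (A.gr.proj_finite u).toFinset k (fun x => B.YL u x k) := by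
  intro n w hw m hm
  simp only
  rw [← A.gr.sum_proj u, map_sum, LinearMap.sum_apply, Finset.sum_apply, map_sum]
  exact Finset.sum_eq_zero fun p hp =>
    B.gr.proj_eq_zero (B.YL_proj_eq_self u p hw k) (hm p (by simpa using hp))

theorem Bimod.shifts_YsR (B : Bimod A W) (u : V) (k : ℤ) :
    B.gr.Shifts (A.gr.proj_finite u).toFinset k (fun x => B.YsR u x k) := by
  intro n w hw m hm
  obtain ⟨N, hN⟩ := B.truncR w u
  simp only
  rw [B.YsR_eq_sum hN (J := (N - k).toNat) (by omega), map_sum]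
  refine Finset.sum_eq_zero fun i _ => ?_
  nth_rewrite 1 [← A.gr.sum_proj u]
  rw [map_smul, map_sum, Finset.sum_apply, map_sum, map_sum, Finset.sum_eq_zero, smul_zero]
  intro p hp
  refine B.gr.proj_eq_zero (B.DW_pow_proj_eq_self (B.YR_proj_eq_self u p hw (k + i)) i) ?_
  convert hm p (by simpa using hp) using 1
  push_cast
  ring

theorem CGrading.ext_emb (G : CGrading W) {L : W → W} (hL : ∀ x y, L (x + y) = L x + L y) (w : W) :
    G.ext L (G.emb w) = G.emb (L w) := by
  refine Subtype.ext (funext fun m => ?_)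
  have h1 := AddMonoidHom.map_finsum (((G.proj m).toAddMonoidHom).comp (AddMonoidHom.mk' L hL))
    (G.proj_finite w)
  rw [G.proj_sum] at h1
  exact h1.symm

theorem CGrading.pair_emb (G : CGrading W) (φ : W →ₗ[ℂ] ℂ) (w : W) : G.pair φ (G.emb w) = φ w := by
  have h1 := AddMonoidHom.map_finsum φ.toAddMonoidHom (G.proj_finite w)
  rw [G.proj_sum] at h1
  exact h1.symm

theorem CGrading.pair_ext_ext_congr (G : CGrading W) {φ : W →ₗ[ℂ] ℂ} {S S' : Finset ℤ} {k k' : ℤ}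
    {L L' : W → W} (hL : G.Shifts S k L) (hL' : G.Shifts S' k' L') {f g : G.Comp}
    (h : ∀ m : ℂ, φ ∘ₗ G.proj m ≠ 0 → ∀ p ∈ S, ∀ p' ∈ S',
      f.1 (m - p - p' + (k + k') + 2) = g.1 (m - p - p' + (k + k') + 2)) :
    G.pair φ (G.ext L (G.ext L' f)) = G.pair φ (G.ext L (G.ext L' g)) := by
  refine finsum_congr fun m => ?_
  by_cases hm : φ ∘ₗ G.proj m = 0
  · have h0 : ∀ x : G.Comp, φ (x.1 m) = 0 := fun x => by
      rw [← x.2 m]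
      exact congrArg (fun T : W →ₗ[ℂ] ℂ => T (x.1 m)) hm
    rw [h0, h0]
  refine congrArg φ (finsum_congr fun n => ?_)
  by_cases hn : ∀ p ∈ S, m ≠ n + p - k - 1
  · rw [hL n _ ((G.ext L' f).2 n) m hn, hL n _ ((G.ext L' g).2 n) m hn]
  push Not at hn
  obtain ⟨p, hp, rfl⟩ := hn
  have e : (G.ext L' f).1 n = (G.ext L' g).1 n := by
    refine finsum_congr fun l => ?_
    by_cases hl : ∀ p' ∈ S', n ≠ l + p' - k' - 1
    · rw [hL' l _ (f.2 l) n hl, hL' l _ (g.2 l) n hl]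
    push Not at hl
    obtain ⟨p', hp', rfl⟩ := hl
    have := h _ hm p hp p' hp'
    rw [show l + (p' : ℂ) - k' - 1 + p - k - 1 - p - p' + (k + k') + 2 = l by ring] at this
    rw [this]
  rw [e]

theorem CGrading.emb_sum_apply (G : CGrading W) (f : G.Comp) (F : Finset ℂ) {n : ℂ} (hn : n ∈ F) :
    (G.emb (∑ l ∈ F, f.1 l)).1 n = f.1 n := by
  have h : G.proj n (∑ l ∈ F, f.1 l) = f.1 n := by
    rw [map_sum, Finset.sum_eq_single_of_mem n hn fun l _ hl =>
      G.proj_eq_zero (f.2 l) hl.symm, f.2 n]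
  exact h

/-- The coefficients of total degree `N` of products of two vertex operators acting on an element
of the completion only see an element of `W`. -/
theorem Bimod.exists_pair_ext_ext_eq (B : Bimod A W) (u₁ u₂ : V) (f : B.gr.Comp) {φ : W →ₗ[ℂ] ℂ}
    (hφ : InGradedDual B.gr.proj φ) (N : ℤ) : ∃ w : W, ∀ k : ℤ × ℤ, k.1 + k.2 = N →
      B.gr.pair φ (B.gr.ext (fun x => B.YL u₁ x k.1) (B.gr.ext (fun x => B.YsR u₂ x k.2) f)) =
        φ (B.YL u₁ (B.YsR u₂ w k.2) k.1) ∧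
      B.gr.pair φ (B.gr.ext (fun x => B.YsR u₂ x k.2) (B.gr.ext (fun x => B.YL u₁ x k.1) f)) =
        φ (B.YsR u₂ (B.YL u₁ w k.1) k.2) := by
  classical
  let S₁ := (A.gr.proj_finite u₁).toFinset
  let S₂ := (A.gr.proj_finite u₂).toFinset
  let F : Finset ℂ := (hφ.toFinset ×ˢ S₁ ×ˢ S₂).image
    fun t => t.1 - (t.2.1 : ℂ) - (t.2.2 : ℂ) + N + 2
  have hF : ∀ m : ℂ, φ ∘ₗ B.gr.proj m ≠ 0 → ∀ p ∈ S₁, ∀ p' ∈ S₂,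
      m - (p : ℂ) - (p' : ℂ) + N + 2 ∈ F := fun m hm p hp p' hp' =>
    Finset.mem_image.2 ⟨(m, p, p'), by
      simp only [Finset.mem_product]; exact ⟨hφ.mem_toFinset.2 hm, hp, hp'⟩, rfl⟩
  have hYL : ∀ (u : V) (k : ℤ) (x y : W), B.YL u (x + y) k = B.YL u x k + B.YL u y k :=
    fun u k x y => by simp
  refine ⟨∑ l ∈ F, f.1 l, fun k hk => ⟨?_, ?_⟩⟩
  · rw [B.gr.pair_ext_ext_congr (g := B.gr.emb (∑ l ∈ F, f.1 l)) (B.shifts_YL u₁ k.1)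
      (B.shifts_YsR u₂ k.2), B.gr.ext_emb fun x y => B.YsR_add u₂ x y k.2, B.gr.ext_emb
      (hYL u₁ k.1), B.gr.pair_emb]
    intro m hm p hp p' hp'
    rw [B.gr.emb_sum_apply]
    rw [← Int.cast_add, hk]
    exact hF m hm p hp p' hp'
  · rw [B.gr.pair_ext_ext_congr (g := B.gr.emb (∑ l ∈ F, f.1 l)) (B.shifts_YsR u₂ k.2)
      (B.shifts_YL u₁ k.1), B.gr.ext_emb (hYL u₁ k.1), B.gr.ext_emb
      fun x y => B.YsR_add u₂ x y k.2, B.gr.pair_emb]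
    intro m hm p hp p' hp'
    rw [B.gr.emb_sum_apply]
    rw [← Int.cast_add, add_comm k.2, hk, sub_right_comm]
    exact hF m hm p' hp' p hp

theorem Bimod.mulSub_pow_pair_eq (B : Bimod A W) (hB : B.PoleOrder) (u₁ u₂ : V) :
    ∃ C : ℕ, ∀ n, C ≤ n → ∀ (f : B.gr.Comp) {φ : W →ₗ[ℂ] ℂ}, InGradedDual B.gr.proj φ →
      (mulSub ^ n) (fun k => B.gr.pair φ
        (B.gr.ext (fun x => B.YL u₁ x k.1) (B.gr.ext (fun x => B.YsR u₂ x k.2) f))) =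
      (mulSub ^ n) fun k => B.gr.pair φ
        (B.gr.ext (fun x => B.YsR u₂ x k.2) (B.gr.ext (fun x => B.YL u₁ x k.1) f)) := by
  obtain ⟨C, hC⟩ := hB.2.2 u₁ u₂
  refine ⟨C, fun n hn f φ hφ => funext fun k => ?_⟩
  obtain ⟨w, hw⟩ := B.exists_pair_ext_ext_eq u₁ u₂ f hφ (k.1 + k.2 + n)
  rw [mulSub_pow_congr fun l hl => (hw l hl).1, mulSub_pow_congr fun l hl => (hw l hl).2,
    ← Nat.sub_add_cancel hn, pow_add, Module.End.mul_apply, Module.End.mul_apply,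
    B.weakComm hC hφ w]

theorem Bimod.diagTrunc_pair (B : Bimod A W) (u₁ u₂ : V) (f : B.gr.Comp) {φ : W →ₗ[ℂ] ℂ}
    (hφ : InGradedDual B.gr.proj φ) : DiagTrunc fun k => B.gr.pair φ
      (B.gr.ext (fun x => B.YsR u₂ x k.2) (B.gr.ext (fun x => B.YL u₁ x k.1) f)) := by
  intro N
  obtain ⟨w, hw⟩ := B.exists_pair_ext_ext_eq u₁ u₂ f hφ N
  obtain ⟨K, hK⟩ := B.truncL u₁ w
  refine ⟨K, fun k hk hk' => ?_⟩
  simp only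
  rw [(hw k hk).2, hK k.1 hk', ← zero_smul ℂ (0 : W), B.YsR_smul, zero_smul, map_zero]

end Completion

section Expansion

variable {n : ℕ}

/-- The points `(z₁, z₂)` off the diagonal with `z₂ ≠ 0` lying outside the discs spanned by
the `zt i`. -/
structure Outer (zt : Fin n → ℂ) (z₁ z₂ : ℂ) : Prop where
  snd_ne_zero : z₂ ≠ 0
  ne : z₁ ≠ z₂
  lt_fst : ∀ i, ‖zt i‖ < ‖z₁‖
  lt_snd : ∀ i, ‖zt i‖ < ‖z₂‖

theorem Outer.fst_ne_zero {zt : Fin n → ℂ} {z₁ z₂ : ℂ} (h : Outer zt z₁ z₂) (hn : n ≠ 0) :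
    z₁ ≠ 0 := by
  obtain ⟨m, rfl⟩ := Nat.exists_eq_succ_of_ne_zero hn
  exact norm_pos_iff.1 ((norm_nonneg _).trans_lt (h.lt_fst 0))

/-- `F` has a Laurent series expansion in `z₁, z₂` on `Outer zt`, regular at `z₁ = 0` when there are
no further variables. -/
def Expands (zt : Fin n → ℂ) (F : ℂ → ℂ → ℂ) : Prop :=
  ∃ c : Arr, (n = 0 → Van c) ∧ ∀ z₁ z₂, Outer zt z₁ z₂ → Ser c z₁ z₂ (F z₁ z₂)

/-- Multiplication by `G` preserves `Expands zt`. -/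
def ExpandsMul (zt : Fin n → ℂ) (G : ℂ → ℂ → ℂ) : Prop :=
  ∀ F, Expands zt F → Expands zt fun z₁ z₂ => F z₁ z₂ * G z₁ z₂

variable {zt : Fin n → ℂ} {F G H : ℂ → ℂ → ℂ}

theorem Expands.congr (h : Expands zt F) (hFG : ∀ z₁ z₂, Outer zt z₁ z₂ → F z₁ z₂ = G z₁ z₂) :
    Expands zt G := by
  obtain ⟨c, hv, hc⟩ := h
  exact ⟨c, hv, fun z₁ z₂ hz => hFG z₁ z₂ hz ▸ hc z₁ z₂ hz⟩

theorem ExpandsMul.congr (h : ExpandsMul zt F)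
    (hFG : ∀ z₁ z₂, Outer zt z₁ z₂ → F z₁ z₂ = G z₁ z₂) : ExpandsMul zt G := fun _ hH =>
  (h _ hH).congr fun z₁ z₂ hz => by rw [hFG z₁ z₂ hz]

theorem Expands.const (a : ℂ) : Expands zt fun _ _ => a :=
  ⟨constArr a, fun _ => constArr_van a, fun z₁ z₂ _ => ser_constArr a z₁ z₂⟩

theorem Expands.add (hF : Expands zt F) (hG : Expands zt G) :
    Expands zt fun z₁ z₂ => F z₁ z₂ + G z₁ z₂ := by
  obtain ⟨c, hv, hc⟩ := hF
  obtain ⟨d, hv', hd⟩ := hG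
  exact ⟨c + d, fun hn k hk => by simp [hv hn k hk, hv' hn k hk],
    fun z₁ z₂ hz => (hc z₁ z₂ hz).add (hd z₁ z₂ hz)⟩

theorem ExpandsMul.const (a : ℂ) : ExpandsMul zt fun _ _ => a := by
  rintro F ⟨c, hv, hc⟩
  refine ⟨a • c, fun hn k hk => by simp [hv hn k hk], fun z₁ z₂ hz => ?_⟩
  beta_reduce
  rw [mul_comm]
  exact (hc z₁ z₂ hz).smul a

theorem ExpandsMul.add (hF : ExpandsMul zt F) (hG : ExpandsMul zt G) :
    ExpandsMul zt fun z₁ z₂ => F z₁ z₂ + G z₁ z₂ := fun H hH =>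
  ((hF H hH).add (hG H hH)).congr fun z₁ z₂ _ => by ring

theorem ExpandsMul.mul (hF : ExpandsMul zt F) (hG : ExpandsMul zt G) :
    ExpandsMul zt fun z₁ z₂ => F z₁ z₂ * G z₁ z₂ := fun H hH =>
  (hG _ (hF H hH)).congr fun z₁ z₂ _ => by ring

theorem ExpandsMul.neg (hF : ExpandsMul zt F) : ExpandsMul zt fun z₁ z₂ => - F z₁ z₂ :=
  (hF.mul (ExpandsMul.const (-1))).congr fun z₁ z₂ _ => by ring

theorem ExpandsMul.pow (hF : ExpandsMul zt F) (m : ℕ) :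
    ExpandsMul zt fun z₁ z₂ => F z₁ z₂ ^ m := by
  induction m with
  | zero => simpa using ExpandsMul.const (zt := zt) 1
  | succ m ih => simpa only [pow_succ] using ih.mul hF

theorem ExpandsMul.prod {ι : Type*} (s : Finset ι) {g : ι → ℂ → ℂ → ℂ}
    (h : ∀ i ∈ s, ExpandsMul zt (g i)) : ExpandsMul zt fun z₁ z₂ => ∏ i ∈ s, g i z₁ z₂ := by
  classical
  induction s using Finset.induction_on with
  | empty => simpa using ExpandsMul.const (zt := zt) 1
  | insert i s hi ih =>
    simp only [Finset.prod_insert hi]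
    exact (h i (Finset.mem_insert_self i s)).mul (ih fun j hj => h j (Finset.mem_insert_of_mem hj))

theorem ExpandsMul.fst : ExpandsMul zt fun z₁ _ => z₁ := by
  rintro F ⟨c, hv, hc⟩
  refine ⟨sh 1 0 c, fun hn => (hv hn).sh zero_le_one 0, fun z₁ z₂ hz => ?_⟩
  have := (hc z₁ z₂ hz).sh 1 0 hz.snd_ne_zero ((em (n = 0)).symm.imp hz.fst_ne_zero
    fun hn => ⟨hv hn, zero_le_one⟩)
  simpa [mul_comm] using this

theorem ExpandsMul.snd : ExpandsMul zt fun _ z₂ => z₂ := by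
  rintro F ⟨c, hv, hc⟩
  refine ⟨sh 0 1 c, fun hn => (hv hn).sh le_rfl 1, fun z₁ z₂ hz => ?_⟩
  have := (hc z₁ z₂ hz).sh 0 1 hz.snd_ne_zero ((em (n = 0)).symm.imp hz.fst_ne_zero
    fun hn => ⟨hv hn, le_rfl⟩)
  simpa [mul_comm] using this

theorem ExpandsMul.fst_sub_snd : ExpandsMul zt fun z₁ z₂ => z₁ - z₂ :=
  (ExpandsMul.fst.add ExpandsMul.snd.neg).congr fun z₁ z₂ _ => by ring

theorem hasSum_inv_sub {z ζ : ℂ} (h : ‖ζ‖ < ‖z‖) :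
    HasSum (fun j : ℕ => ζ ^ j * z ^ (-(j : ℤ) - 1)) (z - ζ)⁻¹ := by
  have hz : z ≠ 0 := norm_pos_iff.1 ((norm_nonneg _).trans_lt h)
  have hlt : ‖ζ / z‖ < 1 := by rwa [norm_div, div_lt_one (norm_pos_iff.2 hz)]
  have := (hasSum_geometric_of_norm_lt_one hlt).mul_left z⁻¹
  rw [← mul_inv, mul_sub, mul_one, mul_div_cancel₀ _ hz] at this
  refine HasSum.of_eq this fun j => ?_
  rw [zpow_sub_one₀ hz, zpow_neg, zpow_natCast, div_pow]
  ring

theorem ExpandsMul.inv_fst_sub (i : Fin n) : ExpandsMul zt fun z₁ _ => (z₁ - zt i)⁻¹ := by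
  have hn : n ≠ 0 := (i.pos).ne'
  rintro F ⟨c, -, hc⟩
  refine ⟨fun k => ∑' j : ℕ, zt i ^ j * c (k.1 + (-(j : ℤ) - 1), k.2 + 0), fun h => absurd h hn,
    fun z₁ z₂ hz => ?_⟩
  beta_reduce
  rw [mul_comm]
  exact (hc z₁ z₂ hz).smear (σ := fun j => -(j : ℤ) - 1) (τ := fun _ => 0)
    (by simpa using hasSum_inv_sub (hz.lt_fst i)) hz.snd_ne_zero (Or.inl (hz.fst_ne_zero hn))

theorem ExpandsMul.inv_snd_sub (i : Fin n) : ExpandsMul zt fun _ z₂ => (z₂ - zt i)⁻¹ := by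
  have hn : n ≠ 0 := (i.pos).ne'
  rintro F ⟨c, -, hc⟩
  refine ⟨fun k => ∑' j : ℕ, zt i ^ j * c (k.1 + 0, k.2 + (-(j : ℤ) - 1)), fun h => absurd h hn,
    fun z₁ z₂ hz => ?_⟩
  beta_reduce
  rw [mul_comm]
  exact (hc z₁ z₂ hz).smear (σ := fun _ => 0) (τ := fun j => -(j : ℤ) - 1)
    (by simpa using hasSum_inv_sub (hz.lt_snd i)) hz.snd_ne_zero (Or.inl (hz.fst_ne_zero hn))

theorem Expands.eval (M : MvPolynomial (Fin (n + 2)) ℂ) :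
    Expands zt fun z₁ z₂ => MvPolynomial.eval
      (Fin.cons z₁ (Fin.cons z₂ zt) : Fin (n + 2) → ℂ) M := by
  induction M using MvPolynomial.induction_on with
  | C a => simpa using Expands.const a
  | add p q hp hq => simpa using hp.add hq
  | mul_X p i hp =>
    simp only [map_mul, MvPolynomial.eval_X]
    induction i using Fin.cases with
    | zero => exact ExpandsMul.fst _ hp
    | succ i =>
      induction i using Fin.cases with
      | zero => exact ExpandsMul.snd _ hp
      | succ i => exact ExpandsMul.const (zt i) _ hp

theorem ExpandsMul.mul_inv_sub {i j : Fin (n + 2)} (hij : i ≠ j) :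
    ExpandsMul zt fun z₁ z₂ => (z₁ - z₂) * ((Fin.cons z₁ (Fin.cons z₂ zt) : Fin (n + 2) → ℂ) i -
      (Fin.cons z₁ (Fin.cons z₂ zt) : Fin (n + 2) → ℂ) j)⁻¹ := by
  have h01 : ExpandsMul zt fun z₁ z₂ => (z₁ - z₂) * (z₁ - z₂)⁻¹ :=
    (ExpandsMul.const 1).congr fun z₁ z₂ hz => (mul_inv_cancel₀ (sub_ne_zero.2 hz.ne)).symm
  have hsymm : ∀ {a b : ℂ → ℂ → ℂ}, ExpandsMul zt (fun z₁ z₂ => (z₁ - z₂) *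
      (a z₁ z₂ - b z₁ z₂)⁻¹) → ExpandsMul zt fun z₁ z₂ => (z₁ - z₂) * (b z₁ z₂ - a z₁ z₂)⁻¹ :=
    fun h => h.neg.congr fun z₁ z₂ _ => by rw [← mul_neg, ← inv_neg, neg_sub]
  induction i using Fin.cases with
  | zero =>
    induction j using Fin.cases with
    | zero => exact absurd rfl hij
    | succ j =>
      induction j using Fin.cases with
      | zero => exact h01
      | succ j => exact ExpandsMul.fst_sub_snd.mul (ExpandsMul.inv_fst_sub j)
  | succ i =>
    induction i using Fin.cases with
    | zero =>
      induction j using Fin.cases with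
      | zero => exact hsymm h01
      | succ j =>
        induction j using Fin.cases with
        | zero => exact absurd rfl hij
        | succ j => exact ExpandsMul.fst_sub_snd.mul (ExpandsMul.inv_snd_sub j)
    | succ i =>
      induction j using Fin.cases with
      | zero => exact hsymm (ExpandsMul.fst_sub_snd.mul (ExpandsMul.inv_fst_sub i))
      | succ j =>
        induction j using Fin.cases with
        | zero => exact hsymm (ExpandsMul.fst_sub_snd.mul (ExpandsMul.inv_snd_sub i))
        | succ j => exact ExpandsMul.fst_sub_snd.mul (ExpandsMul.const (zt i - zt j)⁻¹)

theorem DiagRatFn.exists_expands (R : DiagRatFn (Fin (n + 2))) (C₀ : ℕ) (zt : Fin n → ℂ) :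
    ∃ C, C₀ ≤ C ∧ Expands zt fun z₁ z₂ =>
      (z₁ - z₂) ^ C * R.eval (Fin.cons z₁ (Fin.cons z₂ zt)) := by
  refine ⟨C₀ + ∑ q ∈ Finset.univ.offDiag, R.b q.1 q.2, Nat.le_add_right _ _, ?_⟩
  refine ((ExpandsMul.fst_sub_snd.pow C₀).mul (ExpandsMul.prod Finset.univ.offDiag
    fun q hq => (ExpandsMul.mul_inv_sub (Finset.mem_offDiag.1 hq).2.2).pow (R.b q.1 q.2))
    _ (Expands.eval R.num)).congr fun z₁ z₂ _ => ?_
  rw [pow_add, ← Finset.prod_pow_eq_pow_sum]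
  simp only [mul_pow, inv_pow, Finset.prod_mul_distrib, Finset.prod_inv_distrib, DiagRatFn.eval,
    div_eq_mul_inv]
  ring

end Expansion

theorem conf_cons {n : ℕ} {a : ℂ} {z : Fin n → ℂ} :
    Conf (Fin.cons a z : Fin (n + 1) → ℂ) ↔ (∀ i, a ≠ z i) ∧ Conf z := by
  constructor
  · exact fun h => ⟨fun i => h 0 i.succ (Fin.succ_ne_zero i).symm,
      fun i j hij => h i.succ j.succ fun e => hij (Fin.succ_injective _ e)⟩
  · rintro ⟨h, hz⟩ i j hij
    induction i using Fin.cases with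
    | zero =>
      induction j using Fin.cases with
      | zero => exact absurd rfl hij
      | succ j => exact h j
    | succ i =>
      induction j using Fin.cases with
      | zero => exact (h i).symm
      | succ j => exact hz i j fun e => hij (congrArg Fin.succ e)

theorem Outer.conf {n : ℕ} {zt : Fin n → ℂ} {z₁ z₂ : ℂ} (h : Outer zt z₁ z₂) (hz : Conf zt) :
    Conf (Fin.cons z₁ (Fin.cons z₂ zt) : Fin (n + 2) → ℂ) := by
  refine conf_cons.2 ⟨fun i => ?_, conf_cons.2 ⟨fun i e => ?_, hz⟩⟩
  · induction i using Fin.cases with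
    | zero => exact h.ne
    | succ i => exact fun e => (h.lt_fst i).ne (congrArg norm e).symm
  · exact (h.lt_snd i).ne (congrArg norm e).symm

/-- Let `V` be a MOSVA and `W` a `V`-bimodule, both satisfying the
pole-order condition. Let `u₁, u₂ ∈ V` and `f ∈ W̃_{z₃,…,z_{n+2}}` be such that
`Y_W^L(u₁,z₁)Y_W^{s(R)}(u₂,z₂)f(z₃,…,z_{n+2})` converges absolutely to the
`W̄`-valued rational function `h` whenever `|z₁| > |z₂| > |z_i|`. Then
`Y_W^{s(R)}(u₂,z₂)Y_W^L(u₁,z₁)f(z₃,…,z_{n+2})` converges absolutely to the same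
`W̄`-valued rational function whenever `|z₂| > |z₁| > |z_i|` (so that
`E(Y_W^L(u₁,z₁)Y_W^{s(R)}(u₂,z₂)f) = E(Y_W^{s(R)}(u₂,z₂)Y_W^L(u₁,z₁)f)` as
elements of `W̃_{z₁,…,z_{n+2}}`). -/
theorem statement11 {V : Type*} [AddCommGroup V] [Module ℂ V]
    {W : Type*} [AddCommGroup W] [Module ℂ W]
    (A : MOSVA V) (B : Bimod A W) (hA : A.PoleOrder) (hB : B.PoleOrder)
    (n : ℕ) (u₁ u₂ : V)
    (f : (Fin n → ℂ) → B.gr.Comp) (hfW : B.gr.WTilde f)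
    (h : (Fin (n+2) → ℂ) → B.gr.Comp) (hhW : B.gr.WTilde h)
    (hconv : ∀ (z₁ z₂ : ℂ) (zt : Fin n → ℂ), Conf (Fin.cons z₁ (Fin.cons z₂ zt)) →
      ‖z₂‖ < ‖z₁‖ → (∀ i, ‖zt i‖ < ‖z₂‖) →
      ∀ φ : W →ₗ[ℂ] ℂ, InGradedDual B.gr.proj φ →
        AbsConvTo (fun k : ℤ × ℤ =>
            B.gr.pair φ (B.gr.ext (fun x => B.YL u₁ x k.1)
                (B.gr.ext (fun x => B.YsR u₂ x k.2) (f zt)))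
              * z₁ ^ (-k.1 - 1) * z₂ ^ (-k.2 - 1))
          (B.gr.pair φ (h (Fin.cons z₁ (Fin.cons z₂ zt))))) :
    ∀ (z₁ z₂ : ℂ) (zt : Fin n → ℂ), Conf (Fin.cons z₁ (Fin.cons z₂ zt)) →
      ‖z₁‖ < ‖z₂‖ → (∀ i, ‖zt i‖ < ‖z₁‖) →
      ∀ φ : W →ₗ[ℂ] ℂ, InGradedDual B.gr.proj φ →
        AbsConvTo (fun k : ℤ × ℤ =>
            B.gr.pair φ (B.gr.ext (fun x => B.YsR u₂ x k.2)
                (B.gr.ext (fun x => B.YL u₁ x k.1) (f zt)))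
              * z₁ ^ (-k.1 - 1) * z₂ ^ (-k.2 - 1))
          (B.gr.pair φ (h (Fin.cons z₁ (Fin.cons z₂ zt)))) := by
  intro z₁ z₂ zt hz hlt hzt φ hφ
  have hzt' : Conf zt := (conf_cons.1 (conf_cons.1 hz).2).2
  have h₂ : 0 < ‖z₂‖ := (norm_nonneg _).trans_lt hlt
  obtain ⟨C₀, hC₀⟩ := B.mulSub_pow_pair_eq hB u₁ u₂
  obtain ⟨R, hR⟩ := hhW.1 φ hφ
  obtain ⟨C, hC, c, hcv, hc⟩ := R.exists_expands C₀ zt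
  have hout : Outer zt z₁ z₂ := ⟨norm_pos_iff.1 h₂, fun e => hlt.ne (congrArg norm e), hzt,
    fun i => (hzt i).trans hlt⟩
  have hα : (mulSub ^ C) (fun k => B.gr.pair φ (B.gr.ext (fun x => B.YL u₁ x k.1)
      (B.gr.ext (fun x => B.YsR u₂ x k.2) (f zt)))) = c := by
    refine Ser.ext (ρ₁ := ‖z₂‖ + 1) (ρ₂ := ‖z₂‖) (by linarith) h₂ fun w₁ w₂ hw₁ hw₂ => ?_
    have hw : Outer zt w₁ w₂ := ⟨norm_pos_ne h₂ hw₂, fun e => by rw [e, hw₂] at hw₁; linarith,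
      fun i => by rw [hw₁]; linarith [hout.lt_snd i], fun i => hw₂ ▸ hout.lt_snd i⟩
    have hconf := hw.conf hzt'
    refine ⟨_, ?_, hc w₁ w₂ hw⟩
    beta_reduce
    rw [← hR _ hconf]
    exact Ser.mulSub_pow (absConvTo_iff.1 (hconv w₁ w₂ zt hconf (by rw [hw₁, hw₂]; linarith)
      hw.lt_snd φ hφ)) (norm_pos_ne (by linarith) hw₁) (norm_pos_ne h₂ hw₂) C
  have hβ := (hC₀ C hC (f zt) hφ).symm.trans hα
  rw [absConvTo_iff, hR _ hz]
  have key := Ser.of_mulSub_pow (n := C) (hβ ▸ hc z₁ z₂ hout) (B.diagTrunc_pair u₁ u₂ (f zt) hφ) hlt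
    ((em (n = 0)).symm.imp hout.fst_ne_zero fun hn => hβ ▸ hcv hn)
  rwa [mul_div_cancel_left₀ _ (pow_ne_zero _ (sub_ne_zero.2 hout.ne))] at key

end VA
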